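/- If h: U → ℝ is a subanalytic continuous function on an open subset U of a real analytic manifold, then h is locally Hölder: every point of U has a neighborhood V and constants C > 0, α > 0 such that |h(x) − h(x')| ≤ C|x − x'|^α for all x, x' ∈ V. -/

import Mathlib

open scoped BigOperators

/-- A set `A ⊆ ℝ^n` is semianalytic if, locally, it is a finite union of finite
intersections of sets of the form `{f = 0}` and `{f > 0}` with `f` real analytic. -/
def IsSemianalytic {n : ℕ} (A : Set (Fin n → ℝ)) : Prop :=
  ∀ x : Fin n → ℝ, ∃ U : Set (Fin n → ℝ), IsOpen U ∧ x ∈ U ∧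
    ∃ (K L : ℕ) (f : Fin K → Fin L → (Fin n → ℝ) → ℝ) (sgn : Fin K → Fin L → Bool),
      (∀ a b, AnalyticOn ℝ (f a b) U) ∧
      A ∩ U = (⋃ a, ⋂ b, {y | if sgn a b then 0 < f a b y else f a b y = 0}) ∩ U

/-- A set `A ⊆ ℝ^n` is subanalytic (in the sense of Hironaka) if, locally, it is the
image under the coordinate projection `ℝ^{n+m} → ℝ^n` of a relatively compact
semianalytic set. -/
def IsSubanalytic {n : ℕ} (A : Set (Fin n → ℝ)) : Prop :=
  ∀ x : Fin n → ℝ, ∃ U : Set (Fin n → ℝ), IsOpen U ∧ x ∈ U ∧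
    ∃ (m : ℕ) (B : Set (Fin (n + m) → ℝ)),
      IsSemianalytic B ∧ IsCompact (closure B) ∧
      A ∩ U = ((fun y : Fin (n + m) → ℝ => fun i : Fin n => y (Fin.castAdd m i)) '' B) ∩ U

/-- The graph of `h : ℝ^N ⊇ U → ℝ`, as a subset of `ℝ^{N+1}`. -/
def graphSet {N : ℕ} (U : Set (Fin N → ℝ)) (h : (Fin N → ℝ) → ℝ) :
    Set (Fin (N + 1) → ℝ) :=
  {y | (fun i : Fin N => y (Fin.castAdd 1 i)) ∈ U ∧
    y (Fin.last N) = h fun i : Fin N => y (Fin.castAdd 1 i)}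

section
open Filter Topology
namespace SubHolder

lemma ext_algebra {ι A : Type} [Fintype ι] [DecidableEq ι] [NormedRing A] [NormedAlgebra ℝ A] [CompleteSpace A]
    [NormOneClass A] (f : (ι → ℝ) → ℝ) (hf : AnalyticAt ℝ f 0) :
    ∃ g : (ι → A) → A, AnalyticAt ℝ g 0 ∧ ∃ ρ > (0 : ℝ), ∀ (w : ι → A) (c : ι → ℝ) (lam : A →L[ℝ] ℝ),
      ‖w‖ < ρ → ‖c‖ < ρ → (∀ l : List ι, lam ((l.map w).prod) = (l.map c).prod) →
      lam (g w) = f c := by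
  obtain ⟨p, R, hp⟩ := hf
  let q : FormalMultilinearSeries ℝ (ι → A) A := fun k =>
    ∑ j : Fin k → ι, (p k (fun l => Pi.single (j l) (1 : ℝ))) •
      (ContinuousMultilinearMap.mkPiAlgebraFin ℝ k A).compContinuousLinearMap
        (fun l => ContinuousLinearMap.proj (R := ℝ) (φ := fun _ : ι => A) (j l))
  have hq : ∀ k, ‖q k‖ ≤ (Fintype.card ι : ℝ) ^ k * ‖p k‖ := by
    intro k
    refine ContinuousMultilinearMap.opNorm_le_bound (by positivity) (fun m => ?_)
    have happ : q k m = ∑ j : Fin k → ι, (p k (fun l => Pi.single (j l) (1 : ℝ))) •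
        (List.ofFn (fun l => m l (j l))).prod := by
      simp only [q, sum_apply, smul_apply,
        ContinuousMultilinearMap.compContinuousLinearMap_apply,
        ContinuousMultilinearMap.mkPiAlgebraFin_apply, ContinuousLinearMap.proj_apply]
    rw [happ]
    refine (norm_sum_le _ _).trans ?_
    have : ∀ j ∈ (Finset.univ : Finset (Fin k → ι)), ‖(p k (fun l => Pi.single (j l) (1 : ℝ))) •
        (List.ofFn (fun l => m l (j l))).prod‖ ≤ ‖p k‖ * ∏ i, ‖m i‖ := by
      intro j _
      rw [norm_smul]
      have h1 : ‖p k (fun l => Pi.single (j l) (1 : ℝ))‖ ≤ ‖p k‖ := by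
        refine ((p k).le_opNorm _).trans ?_
        simp [Pi.norm_single]
      have h2 : ‖(List.ofFn (fun l => m l (j l))).prod‖ ≤ ∏ i, ‖m i‖ := by
        refine (List.norm_prod_le _).trans ?_
        rw [List.map_ofFn, List.prod_ofFn]
        exact Finset.prod_le_prod (fun _ _ => norm_nonneg _) (fun l _ => norm_le_pi_norm (m l) (j l))
      exact mul_le_mul h1 h2 (norm_nonneg _) (norm_nonneg _)
    refine (Finset.sum_le_sum this).trans ?_
    simp [mul_assoc]
  have hRp : 0 < p.radius := lt_of_lt_of_le hp.r_pos hp.r_le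
  obtain ⟨r, hr0, hr⟩ := ENNReal.lt_iff_exists_nnreal_btwn.1 hRp
  have hr0' : 0 < r := by exact_mod_cast hr0
  obtain ⟨C, hC0, hC⟩ := p.norm_mul_pow_le_of_lt_radius hr
  have hrad : 0 < q.radius := by
    have : ((r / (Fintype.card ι + 1) : NNReal) : ENNReal) ≤ q.radius := by
      refine q.le_radius_of_bound C (fun k => ?_)
      calc ‖q k‖ * ((r / (Fintype.card ι + 1) : NNReal) : ℝ) ^ k
          ≤ ((Fintype.card ι : ℝ) ^ k * ‖p k‖) * ((r / (Fintype.card ι + 1) : NNReal) : ℝ) ^ k := by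
            gcongr; exact hq k
        _ = (‖p k‖ * (r : ℝ) ^ k) * ((Fintype.card ι : ℝ) / (Fintype.card ι + 1)) ^ k := by
            push_cast; rw [div_pow, div_pow]; ring
        _ ≤ C * 1 := by
            refine mul_le_mul (hC k) ?_ (by positivity) hC0.le
            refine pow_le_one₀ (by positivity) ?_
            rw [div_le_one (by positivity)]; linarith
        _ = C := mul_one _
    refine lt_of_lt_of_le ?_ this
    have : 0 < r / (Fintype.card ι + 1) := by positivity
    exact_mod_cast this
  have hqs := q.hasFPowerSeriesOnBall hrad
  refine ⟨q.sum, hqs.analyticAt, ?_⟩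
  obtain ⟨ρ1, hρ1, hρ1'⟩ := ENNReal.lt_iff_exists_nnreal_btwn.1 (lt_min hrad hp.r_pos)
  refine ⟨ρ1, by exact_mod_cast hρ1, ?_⟩
  intro w c lam hw hc hl
  have hw' : HasSum (fun k => q k (fun _ => w)) (q.sum w) := by
    have := hqs.hasSum (y := w) (by
      rw [Metric.mem_eball, edist_zero_right]
      refine lt_of_lt_of_le ?_ (hρ1'.le.trans (min_le_left _ _))
      rw [enorm_eq_nnnorm]
      exact_mod_cast hw)
    simpa using this
  have hc' : HasSum (fun k => p k (fun _ => c)) (f c) := by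
    have := hp.hasSum (y := c) (by
      rw [Metric.mem_eball, edist_zero_right]
      refine lt_of_lt_of_le ?_ (hρ1'.le.trans (min_le_right _ _))
      rw [enorm_eq_nnnorm]
      exact_mod_cast hc)
    simpa using this
  have h3 := lam.hasSum hw'
  refine HasSum.unique h3 ?_
  convert hc' using 1
  funext k
  have hcs : c = ∑ i, c i • (Pi.single i (1 : ℝ) : ι → ℝ) := by
    ext i; simp [Finset.sum_apply, Pi.single_apply]
  have h4 : p k (fun _ => c) = ∑ j : Fin k → ι, (∏ l, c (j l)) * p k (fun l => Pi.single (j l) (1 : ℝ)) := by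
    conv_lhs => rw [hcs]
    rw [ContinuousMultilinearMap.map_sum]
    refine Finset.sum_congr rfl (fun j _ => ?_)
    rw [ContinuousMultilinearMap.map_smul_univ, smul_eq_mul]
  refine Eq.trans ?_ h4.symm
  simp only [q, sum_apply, map_sum, smul_apply, map_smul,
    ContinuousMultilinearMap.compContinuousLinearMap_apply, ContinuousMultilinearMap.mkPiAlgebraFin_apply,
    ContinuousLinearMap.proj_apply, smul_eq_mul]
  refine Finset.sum_congr rfl (fun j _ => ?_)
  rw [mul_comm]
  congr 1
  have := hl (List.ofFn j)
  rw [List.map_ofFn, List.map_ofFn, List.prod_ofFn (f := c ∘ j)] at this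
  exact this
end SubHolder
end

section
open Filter Topology
namespace SubHolder

/-- Bounded sequences, auxiliary name. -/
abbrev W0 := BoundedContinuousFunction ℕ ℝ

/-- Backward shift. -/
noncomputable def Bsh0 : W0 →L[ℝ] W0 :=
  LinearMap.mkContinuous
    { toFun := fun w => w.compContinuous ⟨Nat.succ, continuous_of_discreteTopology⟩
      map_add' := fun _ _ => rfl
      map_smul' := fun _ _ => rfl } 1 (fun w => by
        rw [one_mul]
        exact (BoundedContinuousFunction.norm_le (norm_nonneg _)).2 (fun n => w.norm_coe_le_norm _))

/-- Forward shift. -/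
noncomputable def Ssh0 : W0 →L[ℝ] W0 :=
  LinearMap.mkContinuous
    { toFun := fun w => BoundedContinuousFunction.ofNormedAddCommGroupDiscrete
        (fun n => Nat.casesOn n 0 (fun m => w m)) ‖w‖ (fun n => by
          cases n with
          | zero => simp
          | succ m => exact w.norm_coe_le_norm m)
      map_add' := fun v w => by
        ext n; cases n <;> simp
      map_smul' := fun c w => by
        ext n; cases n <;> simp } 1 (fun w => by
        rw [one_mul]
        refine (BoundedContinuousFunction.norm_le (norm_nonneg _)).2 (fun n => ?_)
        cases n with
          | zero => simp
          | succ m => exact w.norm_coe_le_norm m)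

/-- Bounded sequences, thought of as coefficients of power series. -/
def W : Type := BoundedContinuousFunction ℕ ℝ

noncomputable instance : NormedAddCommGroup W :=
  inferInstanceAs (NormedAddCommGroup (BoundedContinuousFunction ℕ ℝ))
noncomputable instance : NormedSpace ℝ W :=
  inferInstanceAs (NormedSpace ℝ (BoundedContinuousFunction ℕ ℝ))
instance : CompleteSpace W :=
  inferInstanceAs (CompleteSpace (BoundedContinuousFunction ℕ ℝ))

/-- Backward shift. -/
noncomputable def Bsh : W →L[ℝ] W := Bsh0

/-- Forward shift. -/
noncomputable def Ssh : W →L[ℝ] W := Ssh0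

/-- The coefficient functionals. -/
noncomputable def cf (n : ℕ) : W →L[ℝ] ℝ :=
  (BoundedContinuousFunction.evalCLM ℝ n : W0 →L[ℝ] ℝ)

lemma W_ext {v w : W} (h : ∀ n, cf n v = cf n w) : v = w :=
  BoundedContinuousFunction.ext (f := (v : W0)) (g := (w : W0)) h

lemma Bsh_apply (w : W) (n : ℕ) : cf n (Bsh w) = cf (n + 1) w := rfl
lemma Ssh_zero (w : W) : cf 0 (Ssh w) = 0 := rfl
lemma Ssh_succ (w : W) (n : ℕ) : cf (n + 1) (Ssh w) = cf n w := rfl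

lemma BS (w : W) : Bsh (Ssh w) = w := by
  refine W_ext fun n => ?_
  rw [Bsh_apply, Ssh_succ]

lemma SB {w : W} (h : cf 0 w = 0) : Ssh (Bsh w) = w := by
  refine W_ext fun n => ?_
  cases n with
  | zero => rw [Ssh_zero, h]
  | succ m => rw [Ssh_succ, Bsh_apply]

/-- The constant series `1`. -/
noncomputable def e0 : W := (BoundedContinuousFunction.ofNormedAddCommGroupDiscrete
        (fun n => if n = 0 then 1 else 0) 1 (fun n => by split_ifs <;> simp) : W0)

lemma e0_zero : cf 0 e0 = 1 := rfl
lemma e0_succ (n : ℕ) : cf (n + 1) e0 = 0 := rfl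
lemma Be0 : Bsh e0 = 0 := by
  refine W_ext fun n => ?_
  rw [Bsh_apply, map_zero, e0_succ]

instance : Nontrivial W := ⟨e0, 0, fun h => by
  have := e0_zero
  rw [h, map_zero] at this
  exact zero_ne_one this⟩

/-- Evaluation of the power series with coefficients `w` at `y`. -/
noncomputable def ev (y : ℝ) : W →L[ℝ] ℝ :=
  (cf 0).comp (Ring.inverse (1 - y • Bsh))

lemma norm_Bsh : ‖Bsh‖ ≤ 1 := by
  refine ContinuousLinearMap.opNorm_le_bound _ zero_le_one (fun w => ?_)
  rw [one_mul]
  exact (BoundedContinuousFunction.norm_le (f := (Bsh w : W0)) (norm_nonneg w)).2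
    (fun n => BoundedContinuousFunction.norm_coe_le_norm (w : W0) _)

lemma isUnit_ev {y : ℝ} (hy : |y| < 1) : IsUnit (1 - y • Bsh) := by
  refine isUnit_one_sub_of_norm_lt_one ?_
  rw [norm_smul, Real.norm_eq_abs]
  nlinarith [norm_Bsh, abs_nonneg y, norm_nonneg Bsh]

lemma ev_inv {y : ℝ} (hy : |y| < 1) (w : W) :
    Ring.inverse (1 - y • Bsh) (w - y • Bsh w) = w := by
  have := Ring.inverse_mul_cancel _ (isUnit_ev hy)
  exact DFunLike.congr_fun this w

lemma ev_def (y : ℝ) (w : W) : ev y w = cf 0 (Ring.inverse (1 - y • Bsh) w) := rfl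

lemma ev_S {y : ℝ} (hy : |y| < 1) (w : W) : ev y (Ssh w) = y * ev y w := by
  have h := ev_inv hy (Ssh w)
  rw [BS, map_sub, map_smul] at h
  have h2 := congrArg (cf 0) h
  rw [Ssh_zero] at h2
  rw [ev_def, ev_def]
  rw [map_sub, map_smul, smul_eq_mul] at h2
  linarith

lemma ev_e0 {y : ℝ} (hy : |y| < 1) : ev y e0 = 1 := by
  have h := ev_inv hy e0
  rw [Be0, smul_zero, sub_zero] at h
  rw [ev_def, h, e0_zero]

lemma ev_zero (w : W) : ev 0 w = cf 0 w := by
  rw [ev_def]; simp [Ring.inverse_one]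

lemma ev_Spow {y : ℝ} (hy : |y| < 1) (w : W) (k : ℕ) : ev y ((Ssh ^ k) w) = y ^ k * ev y w := by
  induction k with
  | zero => simp
  | succ k ih =>
    rw [pow_succ', mul_apply_eq_comp, ev_S hy, ih]; ring

lemma ev_analytic {y : ℝ} (hy : |y| < 1) : AnalyticAt ℝ ev y := by
  have h1 : AnalyticAt ℝ (fun z : ℝ => (1 : W →L[ℝ] W) - z • Bsh) y := by fun_prop
  have h2 : AnalyticAt ℝ (Ring.inverse : (W →L[ℝ] W) → (W →L[ℝ] W)) (1 - y • Bsh) := by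
    obtain ⟨u, hu⟩ := isUnit_ev hy
    rw [← hu]; exact analyticAt_inverse u
  have h3 := AnalyticAt.comp (f := fun z : ℝ => (1 : W →L[ℝ] W) - z • Bsh) h2 h1
  have h4 := ((ContinuousLinearMap.compL ℝ W W ℝ)
    (cf 0)).analyticAt (Ring.inverse (1 - y • Bsh))
  exact AnalyticAt.comp (f := fun z : ℝ => Ring.inverse ((1 : W →L[ℝ] W) - z • Bsh)) h4 h3

lemma slice {E : Type} [NormedAddCommGroup E] [NormedSpace ℝ E] [FiniteDimensional ℝ E]
    (f : ℝ × E → ℝ) (hf : AnalyticAt ℝ f 0) :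
    ∃ r > (0 : ℝ), ∃ Φ : E → W, AnalyticAt ℝ Φ 0 ∧
      ∀ᶠ x in 𝓝 (0 : E), ∀ y : ℝ, |y| < 1 → f (r * y, x) = ev y (Φ x) := by
  let n := Module.finrank ℝ E
  let e : E ≃L[ℝ] (Fin n → ℝ) := ContinuousLinearEquiv.ofFinrankEq (by simp [n])
  let T1 : (Option (Fin n) → ℝ) →L[ℝ] ℝ × E :=
    (ContinuousLinearMap.proj (R := ℝ) (φ := fun _ : Option (Fin n) => ℝ) none).prod
      ((e.symm : (Fin n → ℝ) →L[ℝ] E).comp (ContinuousLinearMap.pi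
        (fun i => ContinuousLinearMap.proj (R := ℝ) (φ := fun _ : Option (Fin n) => ℝ) (some i))))
  have hf1 : AnalyticAt ℝ (fun c => f (T1 c)) 0 :=
    AnalyticAt.fun_comp (by rw [map_zero]; exact hf) (T1.analyticAt 0)
  obtain ⟨g, hg, ρ, hρ, hgf⟩ := ext_algebra (A := W →L[ℝ] W) _ hf1
  let c : ℝ × E →L[ℝ] (Option (Fin n) → ℝ) := ContinuousLinearMap.pi (fun o => match o with
    | none => ContinuousLinearMap.fst ℝ ℝ E
    | some i => (ContinuousLinearMap.proj (R := ℝ) (φ := fun _ : Fin n => ℝ) i).comp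
        ((e : E →L[ℝ] (Fin n → ℝ)).comp (ContinuousLinearMap.snd ℝ ℝ E)))
  let T : ℝ × E →L[ℝ] (Option (Fin n) → (W →L[ℝ] W)) := ContinuousLinearMap.pi (fun o => match o with
    | none => (ContinuousLinearMap.fst ℝ ℝ E).smulRight Ssh
    | some i => ((ContinuousLinearMap.proj (R := ℝ) (φ := fun _ : Fin n => ℝ) i).comp
        ((e : E →L[ℝ] (Fin n → ℝ)).comp (ContinuousLinearMap.snd ℝ ℝ E))).smulRight 1)
  have hTc : ∀ z, T1 (c z) = z := by
    intro z
    refine Prod.ext rfl ?_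
    change e.symm (e z.2) = z.2
    simp
  have hev : ∀ᶠ z in 𝓝 (0 : ℝ × E), AnalyticAt ℝ g (T z) ∧ ‖T z‖ < ρ ∧ ‖c z‖ < ρ := by
    refine Filter.Eventually.and ?_ (Filter.Eventually.and ?_ ?_)
    · have : Tendsto T (𝓝 0) (𝓝 0) := by simpa using T.continuous.tendsto 0
      exact this.eventually hg.eventually_analyticAt
    · have : Tendsto (fun z => ‖T z‖) (𝓝 0) (𝓝 0) := by simpa using (T.continuous.norm).tendsto 0
      exact this.eventually (gt_mem_nhds hρ)
    · have : Tendsto (fun z => ‖c z‖) (𝓝 0) (𝓝 0) := by simpa using (c.continuous.norm).tendsto 0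
      exact this.eventually (gt_mem_nhds hρ)
  obtain ⟨δ, hδ, hball⟩ := Metric.eventually_nhds_iff.1 hev
  have hin : ∀ (a : ℝ) (x : E), |a| ≤ δ / 2 → ‖x‖ < δ → dist ((a, x) : ℝ × E) 0 < δ := by
    intro a x ha hx
    rw [dist_zero_right, Prod.norm_def]
    exact max_lt (by rw [Real.norm_eq_abs]; linarith) hx
  refine ⟨δ / 2, by positivity, fun x => g (T (δ / 2, x)) e0, ?_, ?_⟩
  · have h1 : AnalyticAt ℝ (fun x : E => ((δ / 2, x) : ℝ × E)) 0 := by fun_prop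
    have h2 : AnalyticAt ℝ (fun x : E => T (δ / 2, x)) 0 := (T.analyticAt _).fun_comp h1
    have h3 : AnalyticAt ℝ g (T (δ / 2, 0)) :=
      (hball (hin _ _ (by rw [abs_of_pos (by positivity)]) (by simpa using hδ))).1
    have h4 : AnalyticAt ℝ (fun x : E => g (T (δ / 2, x))) 0 := AnalyticAt.fun_comp h3 h2
    exact ((ContinuousLinearMap.apply ℝ W e0).analyticAt _).fun_comp h4
  · filter_upwards [Metric.ball_mem_nhds (0 : E) hδ] with x hx y hy
    rw [mem_ball_zero_iff] at hx
    have hy' : |δ / 2 * y| ≤ δ / 2 := by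
      rw [abs_mul, abs_of_pos (by positivity : 0 < δ / 2)]
      nlinarith
    have k1 := hball (hin (δ / 2) x (by rw [abs_of_pos (by positivity)]) hx)
    have k2 := hball (hin (δ / 2 * y) x hy' hx)
    have := hgf (T (δ / 2, x)) (c (δ / 2 * y, x)) ((ev y).comp (ContinuousLinearMap.apply ℝ W e0))
      k1.2.1 k2.2.2 ?_
    · rw [hTc] at this
      exact this.symm
    · intro l
      induction l with
      | nil => simp [ev_e0 hy]
      | cons a l ih =>
        rw [List.map_cons, List.map_cons, List.prod_cons, List.prod_cons, ← ih]
        simp only [ContinuousLinearMap.comp_apply, ContinuousLinearMap.apply_apply,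
          mul_apply_eq_comp]
        cases a with
        | none =>
          have : T (δ / 2, x) none = (δ / 2) • Ssh := rfl
          rw [this]
          have : c (δ / 2 * y, x) none = δ / 2 * y := rfl
          rw [this, smul_apply, map_smul, ev_S hy, smul_eq_mul, mul_assoc]
        | some i =>
          have : T (δ / 2, x) (some i) = (e x i) • (1 : W →L[ℝ] W) := rfl
          rw [this]
          have : c (δ / 2 * y, x) (some i) = e x i := rfl
          rw [this, smul_apply, map_smul, smul_eq_mul, one_apply_eq_self]
end SubHolder
end

section
open Filter Topology
namespace SubHolder

lemma cf_Bpow (w : W) (n m : ℕ) : cf n ((Bsh ^ m) w) = cf (n + m) w := by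
  induction m generalizing n with
  | zero => simp
  | succ m ih =>
    rw [pow_succ', mul_apply_eq_comp, Bsh_apply, ih]; congr 2; omega

lemma SB_pow (m : ℕ) {w : W} (h : ∀ i < m, cf i w = 0) : (Ssh ^ m) ((Bsh ^ m) w) = w := by
  induction m with
  | zero => simp
  | succ m ih =>
    rw [pow_succ, pow_succ', mul_apply_eq_comp, mul_apply_eq_comp, SB, ih]
    · exact fun i hi => h i (by omega)
    · rw [cf_Bpow, zero_add]; exact h m (by omega)

lemma ev_comp_analytic {X : Type} [NormedAddCommGroup X] [NormedSpace ℝ X] {a : X → ℝ} {u : X → W} {x : X}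
    (ha : AnalyticAt ℝ a x) (hu : AnalyticAt ℝ u x) (h1 : |a x| < 1) :
    AnalyticAt ℝ (fun z => ev (a z) (u z)) x := by
  have h2 : AnalyticAt ℝ (fun z => ev (a z)) x := AnalyticAt.fun_comp (ev_analytic h1) ha
  have h3 := (ContinuousLinearMap.id ℝ (W →L[ℝ] ℝ)).analyticAt_bilinear (ev (a x), u x)
  exact AnalyticAt.fun_comp (f := fun z => (ev (a z), u z)) h3 (h2.prod hu)

/-- An analytic function on a ball vanishing near the centre vanishes on the ball. -/
lemma zero_on_ball {E F : Type} [NormedAddCommGroup E] [NormedSpace ℝ E] [NormedAddCommGroup F]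
    [NormedSpace ℝ F] {φ : E → F} {δ : ℝ} (hδ : 0 < δ)
    (hφ : ∀ x ∈ Metric.ball (0 : E) δ, AnalyticAt ℝ φ x)
    (h0 : ∀ᶠ x in 𝓝 (0 : E), φ x = 0) : ∀ x ∈ Metric.ball (0 : E) δ, φ x = 0 := by
  have hA : AnalyticOnNhd ℝ φ (Metric.ball 0 δ) := hφ
  exact hA.eqOn_zero_of_preconnected_of_eventuallyEq_zero
    (convex_ball (0 : E) δ).isPreconnected (Metric.mem_ball_self hδ) h0

lemma division {E : Type} [NormedAddCommGroup E] [NormedSpace ℝ E] [FiniteDimensional ℝ E]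
    (f : ℝ × E → ℝ) (hf : AnalyticAt ℝ f 0) (hne : ¬ ∀ᶠ z in 𝓝 0, f z = 0) :
    ∃ (m : ℕ) (g : ℝ × E → ℝ), AnalyticAt ℝ g 0 ∧ (¬ ∀ᶠ x in 𝓝 (0 : E), g (0, x) = 0) ∧
      ∀ᶠ z in 𝓝 (0 : ℝ × E), f z = z.1 ^ m * g z := by
  classical
  obtain ⟨r, hr, Φ, hΦ, hfΦ⟩ := slice f hf
  have hy : ∀ᶠ z in 𝓝 (0 : ℝ × E), |z.1 / r| < 1 := by
    have : Tendsto (fun z : ℝ × E => |z.1 / r|) (𝓝 0) (𝓝 0) := by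
      have h : Continuous (fun z : ℝ × E => |z.1 / r|) := by fun_prop
      simpa using h.tendsto 0
    exact this.eventually (gt_mem_nhds one_pos)
  have hsnd : Tendsto (fun z : ℝ × E => z.2) (𝓝 0) (𝓝 0) := by
    simpa using (continuous_snd (X := ℝ) (Y := E)).tendsto 0
  have hf2 : ∀ᶠ z in 𝓝 (0 : ℝ × E), f z = ev (z.1 / r) (Φ z.2) := by
    filter_upwards [hy, hsnd.eventually hfΦ] with z h1 h2
    rw [← h2 _ h1, mul_div_cancel₀ _ hr.ne']
  have hex : ∃ m, ¬ ∀ᶠ x in 𝓝 (0 : E), cf m (Φ x) = 0 := by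
    by_contra hcon
    push Not at hcon
    obtain ⟨δ, hδ, hball⟩ := Metric.eventually_nhds_iff.1 hΦ.eventually_analyticAt
    refine hne ?_
    filter_upwards [hf2, hsnd.eventually (Metric.ball_mem_nhds (0 : E) hδ)] with z h1 h2
    have : Φ z.2 = 0 := by
      refine W_ext fun n => ?_
      rw [map_zero]
      refine zero_on_ball (φ := fun x => cf n (Φ x)) hδ ?_ (by simpa using hcon n) z.2 h2
      intro x hx
      exact ((cf n).analyticAt _).fun_comp (hball hx)
    rw [h1, this, map_zero]
  let m := Nat.find hex
  have hm := Nat.find_spec hex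
  have hlt : ∀ᶠ x in 𝓝 (0 : E), ∀ i ∈ Finset.range m, cf i (Φ x) = 0 := by
    rw [Filter.eventually_all_finset]
    intro i hi
    have := Nat.find_min hex (Finset.mem_range.1 hi)
    push Not at this
    simpa using this
  refine ⟨m, fun z => (r⁻¹) ^ m * ev (z.1 / r) ((Bsh ^ m) (Φ z.2)), ?_, ?_, ?_⟩
  · refine analyticAt_const.mul (ev_comp_analytic ?_ ?_ (by simp))
    · exact (analyticAt_fst).div_const
    · refine ((Bsh ^ m).analyticAt _).fun_comp ?_
      exact AnalyticAt.fun_comp (f := fun z : ℝ × E => z.2) (g := Φ) hΦ analyticAt_snd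
  · intro h
    apply hm
    filter_upwards [h] with x hx
    rw [zero_div, ev_zero, cf_Bpow, zero_add] at hx
    rcases mul_eq_zero.1 hx with h | h
    · exact absurd h (by positivity)
    · exact h
  · filter_upwards [hf2, hy, hsnd.eventually hlt] with z h1 h2 h3
    rw [h1, ← SB_pow m (fun i hi => h3 i (Finset.mem_range.2 hi)), ev_Spow h2]
    rw [SB_pow m (fun i hi => h3 i (Finset.mem_range.2 hi)), div_pow, inv_pow, div_eq_mul_inv]
    ring

lemma sign_pos_mul {a b : ℝ} (ha : 0 < a) : SignType.sign (a * b) = SignType.sign b := by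
  rw [sign_mul, sign_pos ha, one_mul]

lemma an_t {E : Type} [NormedAddCommGroup E] [NormedSpace ℝ E] (z : ℝ × ℝ × E) :
    AnalyticAt ℝ (fun z : ℝ × ℝ × E => z.2.1) z :=
  AnalyticAt.fun_comp (f := fun z : ℝ × ℝ × E => z.2) (g := fun w : ℝ × E => w.1)
    analyticAt_fst analyticAt_snd

lemma an_y {E : Type} [NormedAddCommGroup E] [NormedSpace ℝ E] (z : ℝ × ℝ × E) :
    AnalyticAt ℝ (fun z : ℝ × ℝ × E => z.2.2) z :=
  AnalyticAt.fun_comp (f := fun z : ℝ × ℝ × E => z.2) (g := fun w : ℝ × E => w.2)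
    analyticAt_snd analyticAt_snd

lemma normal_form {E : Type} [NormedAddCommGroup E] [NormedSpace ℝ E] [FiniteDimensional ℝ E]
    (f : ℝ × ℝ × E → ℝ) (hf : AnalyticAt ℝ f 0) :
    ∃ e : ℕ, ∀ K ≥ e, ∃ F : ℝ × ℝ × E → ℝ, AnalyticAt ℝ F 0 ∧
      (F = 0 ∨ ¬ ∀ᶠ y in 𝓝 (0 : E), F (0, 0, y) = 0) ∧
      ∀ᶠ z in 𝓝 (0 : ℝ × ℝ × E), 0 < z.1 → 0 < z.2.1 →
        SignType.sign (f (z.2.1 ^ K * z.1, z.2.1, z.2.2)) = SignType.sign (F z) := by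
  have hsub : ∀ K : ℕ, Tendsto (fun z : ℝ × ℝ × E => (z.2.1 ^ K * z.1, z.2.1, z.2.2)) (𝓝 0) (𝓝 0) := by
    intro K
    have h : Continuous (fun z : ℝ × ℝ × E => (z.2.1 ^ K * z.1, z.2.1, z.2.2)) := by fun_prop
    simpa [Prod.mk_zero_zero] using h.tendsto 0
  have hsubA : ∀ K : ℕ, AnalyticAt ℝ (fun z : ℝ × ℝ × E => (z.2.1 ^ K * z.1, z.2.1, z.2.2)) 0 := by
    intro K
    exact (((an_t 0).pow K).mul analyticAt_fst).prod ((an_t 0).prod (an_y 0))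
  by_cases h0 : ∀ᶠ z in 𝓝 0, f z = 0
  · refine ⟨0, fun K _ => ⟨0, analyticAt_const, Or.inl rfl, ?_⟩⟩
    filter_upwards [(hsub K).eventually h0] with z hz _ _
    rw [hz]; rfl
  obtain ⟨m, g, hg, hg0, hfg⟩ := division f hf h0
  have hga : AnalyticAt ℝ (fun w : ℝ × E => g (0, w)) 0 :=
    AnalyticAt.fun_comp (f := fun w : ℝ × E => ((0 : ℝ), w)) (g := g) hg
      (by fun_prop)
  obtain ⟨e, p, hp, hp0, hgp⟩ := division _ hga hg0
  have hq : ∃ q : ℝ × ℝ × E → ℝ, AnalyticAt ℝ q 0 ∧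
      ∀ᶠ z in 𝓝 (0 : ℝ × ℝ × E), g z - g (0, z.2) = z.1 * q z := by
    have hd : AnalyticAt ℝ (fun z : ℝ × ℝ × E => g z - g (0, z.2)) 0 := by
      refine hg.sub ?_
      exact AnalyticAt.fun_comp (f := fun w : ℝ × ℝ × E => ((0 : ℝ), w.2)) (g := g) hg
        (analyticAt_const.prod analyticAt_snd)
    by_cases h1 : ∀ᶠ z in 𝓝 (0 : ℝ × ℝ × E), g z - g (0, z.2) = 0
    · exact ⟨0, analyticAt_const, by simpa using h1⟩
    obtain ⟨k, q, hq, hq0, hqq⟩ := division _ hd h1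
    cases k with
    | zero =>
      exfalso
      apply hq0
      have ht : Tendsto (fun w : ℝ × E => ((0 : ℝ), w)) (𝓝 0) (𝓝 0) := by
        have h : Continuous (fun w : ℝ × E => ((0 : ℝ), w)) := by fun_prop
        simpa [Prod.mk_zero_zero] using h.tendsto 0
      filter_upwards [ht.eventually hqq] with w hw
      simpa using hw.symm
    | succ k =>
      refine ⟨fun z => z.1 ^ k * q z, (analyticAt_fst.pow k).mul hq, ?_⟩
      filter_upwards [hqq] with z hz
      rw [hz]; ring
  obtain ⟨q, hqa, hqe⟩ := hq
  refine ⟨e, fun K hK => ⟨fun z => p z.2 + z.2.1 ^ (K - e) * z.1 * q (z.2.1 ^ K * z.1, z.2.1, z.2.2),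
    ?_, Or.inr ?_, ?_⟩⟩
  · refine AnalyticAt.add ?_ (AnalyticAt.mul (((an_t 0).pow _).mul analyticAt_fst) ?_)
    · exact AnalyticAt.fun_comp (f := fun w : ℝ × ℝ × E => w.2) (g := p) hp analyticAt_snd
    · exact AnalyticAt.fun_comp (f := fun z : ℝ × ℝ × E => (z.2.1 ^ K * z.1, z.2.1, z.2.2)) (g := q)
        (by simpa [Prod.mk_zero_zero] using hqa) (hsubA K)
  · simpa using hp0
  · have hsnd : Tendsto (fun z : ℝ × ℝ × E => z.2) (𝓝 0) (𝓝 0) := by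
      simpa using (continuous_snd (X := ℝ) (Y := ℝ × E)).tendsto 0
    filter_upwards [(hsub K).eventually hfg, (hsub K).eventually hqe, hsnd.eventually hgp]
      with z h1 h2 h3 hs ht
    have h4 : f (z.2.1 ^ K * z.1, z.2.1, z.2.2) = ((z.2.1 ^ K * z.1) ^ m * z.2.1 ^ e) *
        (p z.2 + z.2.1 ^ (K - e) * z.1 * q (z.2.1 ^ K * z.1, z.2.1, z.2.2)) := by
      have hK' : z.2.1 ^ K = z.2.1 ^ e * z.2.1 ^ (K - e) := by rw [← pow_add]; congr 1; omega
      have h5 : g (z.2.1 ^ K * z.1, z.2.1, z.2.2) = z.2.1 ^ e * p z.2 +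
        z.2.1 ^ K * z.1 * q (z.2.1 ^ K * z.1, z.2.1, z.2.2) := by
        have h3' : g (0, z.2.1, z.2.2) = z.2.1 ^ e * p z.2 := h3
        linarith
      rw [h1]
      rw [h5]
      have : z.2.1 ^ K * z.1 * q (z.2.1 ^ K * z.1, z.2.1, z.2.2) = z.2.1 ^ e * z.2.1 ^ (K - e) * z.1 * q (z.2.1 ^ K * z.1, z.2.1, z.2.2) := by
        rw [← hK']
      rw [this]; ring
    rw [h4, sign_pos_mul (by positivity)]
end SubHolder
end

section
open Filter Topology
namespace SubHolder

noncomputable def Tw (d : ℕ) (u0 : W) : ((Fin d → ℝ) × W) →L[ℝ] W :=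
  (Ssh ^ d).comp (ContinuousLinearMap.snd ℝ (Fin d → ℝ) W) +
    ∑ i : Fin d, ((ContinuousLinearMap.proj (R := ℝ) (φ := fun _ : Fin d => ℝ) i).comp
      (ContinuousLinearMap.fst ℝ (Fin d → ℝ) W)).smulRight ((Ssh ^ (i : ℕ)) u0)

lemma Tw_apply (d : ℕ) (u0 : W) (z : (Fin d → ℝ) × W) :
    Tw d u0 z = (Ssh ^ d) z.2 + ∑ i : Fin d, z.1 i • (Ssh ^ (i : ℕ)) u0 := by
  simp [Tw]

lemma Tw_surj {u0 : W} (h0 : cf 0 u0 ≠ 0) (d : ℕ) (w : W) :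
    ∃ (p : Fin d → ℝ) (u : W), (Ssh ^ d) u + ∑ i : Fin d, p i • (Ssh ^ (i : ℕ)) u0 = w := by
  induction d with
  | zero => exact ⟨fun _ => 0, w, by simp⟩
  | succ d ih =>
    obtain ⟨p, u, h⟩ := ih
    set c := cf 0 u / cf 0 u0 with hc
    have h1 : cf 0 (u - c • u0) = 0 := by
      rw [map_sub, map_smul, hc, smul_eq_mul, div_mul_cancel₀ _ h0, sub_self]
    refine ⟨Fin.snoc (α := fun _ => ℝ) p c, Bsh (u - c • u0), ?_⟩
    rw [pow_succ, mul_apply_eq_comp, SB h1, Fin.sum_univ_castSucc]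
    simp only [Fin.snoc_castSucc, Fin.snoc_last, Fin.val_castSucc, Fin.val_last]
    rw [map_sub, map_smul, ← h]
    abel

lemma Tw_inj {u0 : W} (h0 : cf 0 u0 ≠ 0) (d : ℕ) (p : Fin d → ℝ) (u : W)
    (h : (Ssh ^ d) u + ∑ i : Fin d, p i • (Ssh ^ (i : ℕ)) u0 = 0) : p = 0 ∧ u = 0 := by
  induction d generalizing u with
  | zero => exact ⟨Subsingleton.elim _ _, by simpa using h⟩
  | succ d ih =>
    rw [Fin.sum_univ_castSucc] at h
    simp only [Fin.val_castSucc, Fin.val_last] at h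
    have h2 := ih (fun i => p i.castSucc) (Ssh u + p (Fin.last d) • u0) (by
      rw [map_add, map_smul, ← mul_apply_eq_comp, ← pow_succ, ← h]; abel)
    obtain ⟨hp, hu⟩ := h2
    have h3 : p (Fin.last d) = 0 := by
      have := congrArg (cf 0) hu
      rw [map_add, map_smul, Ssh_zero, map_zero, zero_add, smul_eq_mul] at this
      exact (mul_eq_zero.1 this).resolve_right h0
    constructor
    · funext i
      refine Fin.lastCases ?_ (fun j => ?_) i
      · exact h3
      · exact congrFun hp j
    · rw [h3, zero_smul, add_zero] at hu
      rw [← BS u, hu, map_zero]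

noncomputable def Mw (d : ℕ) (z : (Fin d → ℝ) × W) : W :=
  (Ssh ^ d) z.2 + ∑ i : Fin d, z.1 i • (Ssh ^ (i : ℕ)) z.2

lemma an_coord {d : ℕ} {E : Type} [NormedAddCommGroup E] [NormedSpace ℝ E] (i : Fin d)
    (z : (Fin d → ℝ) × E) : AnalyticAt ℝ (fun z : (Fin d → ℝ) × E => z.1 i) z :=
  ((ContinuousLinearMap.proj (R := ℝ) (φ := fun _ : Fin d => ℝ) i).comp
      (ContinuousLinearMap.fst ℝ (Fin d → ℝ) E)).analyticAt z

lemma Mw_analytic (d : ℕ) (z : (Fin d → ℝ) × W) : AnalyticAt ℝ (Mw d) z := by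
  have h : ∀ k : ℕ, AnalyticAt ℝ (fun z : (Fin d → ℝ) × W => (Ssh ^ k) z.2) z := fun k =>
    ((Ssh ^ k).comp (ContinuousLinearMap.snd ℝ (Fin d → ℝ) W)).analyticAt z
  refine (h d).add ?_
  refine Finset.analyticAt_fun_sum _ fun i _ => ?_
  exact (an_coord i z).smul (h i)

lemma Mw_deriv (d : ℕ) (u0 : W) : HasStrictFDerivAt (Mw d) (Tw d u0) (0, u0) := by
  have h : ∀ k : ℕ, HasStrictFDerivAt (fun z : (Fin d → ℝ) × W => (Ssh ^ k) z.2)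
    ((Ssh ^ k).comp (ContinuousLinearMap.snd ℝ (Fin d → ℝ) W)) (0, u0) := fun k =>
    ((Ssh ^ k).comp (ContinuousLinearMap.snd ℝ (Fin d → ℝ) W)).hasStrictFDerivAt
  have h2 : ∀ i : Fin d, HasStrictFDerivAt (fun z : (Fin d → ℝ) × W => z.1 i)
    ((ContinuousLinearMap.proj (R := ℝ) (φ := fun _ : Fin d => ℝ) i).comp
      (ContinuousLinearMap.fst ℝ (Fin d → ℝ) W)) (0, u0) := fun i =>
    ((ContinuousLinearMap.proj (R := ℝ) (φ := fun _ : Fin d => ℝ) i).comp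
      (ContinuousLinearMap.fst ℝ (Fin d → ℝ) W)).hasStrictFDerivAt
  have h3 := (h d).fun_add (HasStrictFDerivAt.fun_sum (u := Finset.univ)
    fun i _ => (h2 i).fun_smul (h i))
  refine h3.congr_fderiv ?_
  ext z
  · simp [Tw]
  · simp [Tw]

lemma weier {E : Type} [NormedAddCommGroup E] [NormedSpace ℝ E] [FiniteDimensional ℝ E]
    (F : ℝ × E → ℝ) (hF : AnalyticAt ℝ F 0) (hne : ¬ ∀ᶠ y in 𝓝 (0 : ℝ), F (y, 0) = 0) :
    ∃ (d : ℕ) (a : ℕ → E → ℝ) (c : SignType), (∀ i, AnalyticAt ℝ (a i) 0) ∧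
      ∀ᶠ z in 𝓝 (0 : ℝ × E), SignType.sign (F z) =
        c * SignType.sign (∑ i ∈ Finset.range (d + 1), a i z.2 * z.1 ^ i) := by
  classical
  obtain ⟨r, hr, Φ, hΦ, hfΦ⟩ := slice F hF
  have hy : ∀ᶠ z in 𝓝 (0 : ℝ × E), |z.1 / r| < 1 := by
    have : Tendsto (fun z : ℝ × E => |z.1 / r|) (𝓝 0) (𝓝 0) := by
      have h : Continuous (fun z : ℝ × E => |z.1 / r|) := by fun_prop
      simpa using h.tendsto 0
    exact this.eventually (gt_mem_nhds one_pos)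
  have hsnd : Tendsto (fun z : ℝ × E => z.2) (𝓝 0) (𝓝 0) := by
    simpa using (continuous_snd (X := ℝ) (Y := E)).tendsto 0
  have hf2 : ∀ᶠ z in 𝓝 (0 : ℝ × E), F z = ev (z.1 / r) (Φ z.2) := by
    filter_upwards [hy, hsnd.eventually hfΦ] with z h1 h2
    rw [← h2 _ h1, mul_div_cancel₀ _ hr.ne']
  have hex : ∃ d, cf d (Φ 0) ≠ 0 := by
    by_contra hcon
    push Not at hcon
    have h0 : Φ 0 = 0 := W_ext fun n => by rw [hcon n, map_zero]
    apply hne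
    have ht : Tendsto (fun y : ℝ => (y, (0 : E))) (𝓝 0) (𝓝 0) := by
      have h : Continuous (fun y : ℝ => (y, (0 : E))) := by fun_prop
      simpa [Prod.mk_zero_zero] using h.tendsto 0
    filter_upwards [ht.eventually hf2] with y hy
    rw [hy, h0, map_zero]
  obtain ⟨d, hd, hmin⟩ : ∃ d, cf d (Φ 0) ≠ 0 ∧ ∀ i < d, cf i (Φ 0) = 0 :=
    ⟨Nat.find hex, Nat.find_spec hex, fun i hi => by simpa using Nat.find_min hex hi⟩
  set u0 := (Bsh ^ d) (Φ 0) with hu0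
  have hu00 : cf 0 u0 ≠ 0 := by rw [hu0, cf_Bpow, zero_add]; exact hd
  have hSu : (Ssh ^ d) u0 = Φ 0 := SB_pow d hmin
  let e : ((Fin d → ℝ) × W) ≃L[ℝ] W := ContinuousLinearEquiv.ofBijective (Tw d u0)
    (by
      rw [LinearMap.ker_eq_bot']
      intro z hz
      have hz' : Tw d u0 z = 0 := hz
      rw [Tw_apply] at hz'
      have := Tw_inj hu00 d _ _ hz'
      exact Prod.ext this.1 this.2)
    (by
      rw [LinearMap.range_eq_top]
      intro w
      obtain ⟨p, u, h⟩ := Tw_surj hu00 d w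
      exact ⟨(p, u), by
        change Tw d u0 (p, u) = w
        rw [Tw_apply]; exact h⟩)
  have he : (e : ((Fin d → ℝ) × W) →L[ℝ] W) = Tw d u0 :=
    ContinuousLinearEquiv.coe_ofBijective _ _ _
  have hder : HasStrictFDerivAt (Mw d) (e : ((Fin d → ℝ) × W) →L[ℝ] W) (0, u0) := by
    rw [he]; exact Mw_deriv d u0
  have hM0 : Mw d (0, u0) = Φ 0 := by simp [Mw, hSu]
  let H := hder.toOpenPartialHomeomorph (Mw d)
  have hHc : (H : (Fin d → ℝ) × W → W) = Mw d := hder.toOpenPartialHomeomorph_coe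
  have hsrc : (0, u0) ∈ H.source := hder.mem_toOpenPartialHomeomorph_source
  have hsymm : AnalyticAt ℝ H.symm (Φ 0) := by
    have := H.analyticAt_symm' (i := e) hsrc (by rw [hHc]; exact Mw_analytic _ _)
      (by rw [hHc]; exact hder.hasFDerivAt.fderiv)
    rwa [hHc, hM0] at this
  have hG : AnalyticAt ℝ (fun x => H.symm (Φ x)) 0 := hsymm.fun_comp hΦ
  have hG0 : H.symm (Φ 0) = (0, u0) := by
    rw [← hM0, ← hHc]; exact H.left_inv hsrc
  have hinv : ∀ᶠ x in 𝓝 (0 : E), Mw d (H.symm (Φ x)) = Φ x := by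
    have h1 : ∀ᶠ w in 𝓝 (Φ 0), H (H.symm w) = w := by
      apply H.eventually_right_inverse
      rw [← hM0, ← hHc]; exact H.map_source hsrc
    rw [hHc] at h1
    exact hΦ.continuousAt.eventually h1
  have hcst : ContinuousAt (fun z : ℝ × E => ev (z.1 / r) (H.symm (Φ z.2)).2) 0 := by
    refine (ev_comp_analytic (a := fun z : ℝ × E => z.1 / r)
      (u := fun z : ℝ × E => (H.symm (Φ z.2)).2) (analyticAt_fst).div_const ?_ (by simp)).continuousAt
    refine AnalyticAt.fun_comp (g := fun q : (Fin d → ℝ) × W => q.2)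
      (f := fun z : ℝ × E => H.symm (Φ z.2)) analyticAt_snd ?_
    exact AnalyticAt.fun_comp (f := fun z : ℝ × E => z.2) (g := fun x => H.symm (Φ x))
      hG analyticAt_snd
  have hsgn : ∀ᶠ z in 𝓝 (0 : ℝ × E), SignType.sign (ev (z.1 / r) (H.symm (Φ z.2)).2) =
      SignType.sign (cf 0 u0) := by
    have hv : (fun z : ℝ × E => ev (z.1 / r) (H.symm (Φ z.2)).2) 0 = cf 0 u0 := by
      simp [hG0, ev_zero]
    rcases lt_or_gt_of_ne hu00 with h | h
    · filter_upwards [hcst.eventually (gt_mem_nhds (by rw [hv]; exact h))] with z hz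
      rw [sign_neg h, sign_neg hz]
    · filter_upwards [hcst.eventually (lt_mem_nhds (by rw [hv]; exact h))] with z hz
      rw [sign_pos h, sign_pos hz]
  refine ⟨d, fun i x => if h : i < d then (H.symm (Φ x)).1 ⟨i, h⟩ * (r⁻¹) ^ i else (r⁻¹) ^ i,
    SignType.sign (cf 0 u0), ?_, ?_⟩
  · intro i
    by_cases h : i < d
    · simp only [h, dif_pos]
      refine AnalyticAt.mul ?_ analyticAt_const
      exact AnalyticAt.fun_comp (g := fun q : (Fin d → ℝ) × W => q.1 ⟨i, h⟩)
        (f := fun x : E => H.symm (Φ x)) (an_coord _ _) hG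
    · simp only [h, dif_neg, not_false_eq_true]; exact analyticAt_const
  · filter_upwards [hy, hf2, hsgn, hsnd.eventually hinv] with z h1 h2 h3 h4
    have h5 : F z = ev (z.1 / r) (H.symm (Φ z.2)).2 * (∑ i ∈ Finset.range (d + 1),
      (if h : i < d then (H.symm (Φ z.2)).1 ⟨i, h⟩ * (r⁻¹) ^ i else (r⁻¹) ^ i) * z.1 ^ i) := by
      rw [h2]
      conv_lhs => rw [← h4]
      rw [Mw, map_add, ev_Spow h1, map_sum, Finset.sum_range_succ, Finset.sum_range, mul_add, Finset.mul_sum, add_comm]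
      congr 1
      · refine Finset.sum_congr rfl fun i _ => ?_
        rw [map_smul, ev_Spow h1, dif_pos i.2, smul_eq_mul, div_eq_mul_inv, mul_pow]
        ring
      · rw [dif_neg (lt_irrefl d), div_eq_mul_inv, mul_pow]; ring
    rw [h5, sign_mul, h3]
end SubHolder
end

section
open Filter Topology
namespace SubHolder
open Polynomial

/-! ### One-quantifier elimination -/

section real
lemma poly_mono (P : ℝ[X]) {x y : ℝ} (h : ∀ z ∈ Set.Ioo x y, 0 ≤ P.derivative.eval z) :
    MonotoneOn (fun z => P.eval z) (Set.Icc x y) := by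
  refine monotoneOn_of_deriv_nonneg (convex_Icc x y) P.continuous.continuousOn
    P.differentiable.differentiableOn ?_
  intro z hz
  rw [interior_Icc] at hz
  rw [Polynomial.deriv]; exact h z hz

lemma poly_anti (P : ℝ[X]) {x y : ℝ} (h : ∀ z ∈ Set.Ioo x y, P.derivative.eval z ≤ 0) :
    AntitoneOn (fun z => P.eval z) (Set.Icc x y) := by
  refine antitoneOn_of_deriv_nonpos (convex_Icc x y) P.continuous.continuousOn
    P.differentiable.differentiableOn ?_
  intro z hz
  rw [interior_Icc] at hz
  rw [Polynomial.deriv]; exact h z hz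

lemma sign_le_iff_nonneg {a : ℝ} : 0 ≤ SignType.sign a ↔ 0 ≤ a := sign_nonneg_iff

/-- constant sign of the derivative gives values between the endpoint values -/
lemma poly_between (P : ℝ[X]) {x y : ℝ} (σ : SignType)
    (h : ∀ z ∈ Set.Ioo x y, SignType.sign (P.derivative.eval z) = σ) {z : ℝ} (hz : z ∈ Set.Icc x y) :
    (P.eval x ≤ P.eval z ∧ P.eval z ≤ P.eval y) ∨ (P.eval y ≤ P.eval z ∧ P.eval z ≤ P.eval x) := by
  have hxy : x ≤ y := hz.1.trans hz.2
  rcases le_total 0 σ with hs | hs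
  · left
    have hm := poly_mono P (x := x) (y := y) fun w hw => by
      rw [← sign_nonneg_iff, h w hw]; exact hs
    exact ⟨hm (Set.left_mem_Icc.2 hxy) hz hz.1, hm hz (Set.right_mem_Icc.2 hxy) hz.2⟩
  · right
    have hm := poly_anti P (x := x) (y := y) fun w hw => by
      rw [← sign_nonpos_iff, h w hw]; exact hs
    exact ⟨hm hz (Set.right_mem_Icc.2 hxy) hz.2, hm (Set.left_mem_Icc.2 hxy) hz hz.1⟩

lemma sign_between {a b c : ℝ} (h : SignType.sign a = SignType.sign b)
    (hc : (a ≤ c ∧ c ≤ b) ∨ (b ≤ c ∧ c ≤ a)) : SignType.sign c = SignType.sign a := by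
  rcases hc with ⟨h1, h2⟩ | ⟨h1, h2⟩
  · apply le_antisymm
    · rw [h]; exact SignType.sign.monotone h2
    · exact SignType.sign.monotone h1
  · apply le_antisymm
    · exact SignType.sign.monotone h2
    · rw [h]; exact SignType.sign.monotone h1

end real

section ring
variable {R : Type} [CommRing R]

/-- sign of the specialisation of `p` at `x` -/
noncomputable def sg (φ : R →+* ℝ) (p : R[X]) (x : ℝ) : SignType :=
  SignType.sign ((p.map φ).eval x)

def DCl (D : Set R[X]) : Prop := ∀ q ∈ D, q.natDegree ≠ 0 → derivative q ∈ D

lemma sg_const (φ : R →+* ℝ) {p : R[X]} (h : p.natDegree = 0) (x y : ℝ) : sg φ p x = sg φ p y := by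
  rw [natDegree_eq_zero] at h
  obtain ⟨c, rfl⟩ := h
  simp [sg]

lemma thom (φ : R →+* ℝ) {D : Set R[X]} (hD : DCl D) {x y : ℝ}
    (h : ∀ q ∈ D, sg φ q x = sg φ q y) :
    ∀ n, ∀ q ∈ D, q.natDegree ≤ n → ∀ z ∈ Set.Icc x y, sg φ q z = sg φ q x := by
  intro n
  induction n with
  | zero => intro q _ h0 z _; exact sg_const φ (by omega) _ _
  | succ n ih =>
    intro q hq hn z hz
    by_cases h0 : q.natDegree = 0
    · exact sg_const φ h0 _ _
    have hd := ih _ (hD q hq h0) (by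
      have := natDegree_derivative_lt h0; omega)
    refine sign_between (h q hq) (poly_between (q.map φ) (sg φ (derivative q) x) ?_ hz)
    intro w hw
    rw [derivative_map]
    exact hd w ⟨hw.1.le, hw.2.le⟩

def Sim (D : Set R[X]) (φ ψ : R →+* ℝ) (x x' : ℝ) : Prop := ∀ q ∈ D, sg φ q x = sg ψ q x'

lemma order_lemma {D : Set R[X]} (hD : DCl D) {φ ψ : R →+* ℝ} {x y x' y' : ℝ}
    (hx : Sim D φ ψ x x') (hy : Sim D φ ψ y y') (hxy : x < y) (hne : ¬ Sim D φ φ x y) :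
    x' < y' := by
  classical
  by_contra hcon
  push Not at hcon
  unfold Sim at hne
  push Not at hne
  have hex : ∃ n, ∃ q ∈ D, sg φ q x ≠ sg φ q y ∧ q.natDegree = n := by
    obtain ⟨q, hq, h⟩ := hne
    exact ⟨_, q, hq, h, rfl⟩
  obtain ⟨q, hq, hqne, hqn⟩ := Nat.find_spec hex
  set n := Nat.find hex with hn
  have hmin : ∀ g ∈ D, g.natDegree < n → sg φ g x = sg φ g y := by
    intro g hg hlt
    by_contra h
    exact Nat.find_min hex hlt ⟨g, hg, h, rfl⟩
  have h0 : q.natDegree ≠ 0 := fun h => hqne (sg_const φ h _ _)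
  let D' : Set R[X] := {g | g ∈ D ∧ g.natDegree < n}
  have hD' : DCl D' := by
    intro g hg hg0
    exact ⟨hD g hg.1 hg0, (natDegree_derivative_lt hg0).trans hg.2⟩
  have hqd : derivative q ∈ D' := ⟨hD q hq h0, by have := natDegree_derivative_lt h0; omega⟩
  have t1 := thom φ hD' (x := x) (y := y) (fun g hg => hmin g hg.1 hg.2) _ _ hqd le_rfl
  have t2 := thom ψ hD' (x := y') (y := x') (fun g hg => by
    rw [← hx g hg.1, ← hy g hg.1]; exact (hmin g hg.1 hg.2).symm) _ _ hqd le_rfl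
  have t3 : sg ψ (derivative q) y' = sg φ (derivative q) x := by
    rw [← hy _ hqd.1]; exact (hmin _ hqd.1 hqd.2).symm
  rcases le_total 0 (sg φ (derivative q) x) with hs | hs
  · have m1 := poly_mono (q.map φ) (x := x) (y := y) fun w hw => by
      rw [← sign_nonneg_iff, derivative_map]
      exact hs.trans_eq (t1 w ⟨hw.1.le, hw.2.le⟩).symm
    have m2 := poly_mono (q.map ψ) (x := y') (y := x') fun w hw => by
      rw [← sign_nonneg_iff, derivative_map]
      exact hs.trans_eq ((t2 w ⟨hw.1.le, hw.2.le⟩).trans t3).symm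
    have a1 : sg φ q x ≤ sg φ q y := SignType.sign.monotone
      (m1 (Set.left_mem_Icc.2 hxy.le) (Set.right_mem_Icc.2 hxy.le) hxy.le)
    have a2 : sg ψ q y' ≤ sg ψ q x' := SignType.sign.monotone
      (m2 (Set.left_mem_Icc.2 hcon) (Set.right_mem_Icc.2 hcon) hcon)
    rw [← hx q hq, ← hy q hq] at a2
    exact hqne (le_antisymm a1 a2)
  · have m1 := poly_anti (q.map φ) (x := x) (y := y) fun w hw => by
      rw [← sign_nonpos_iff, derivative_map]
      exact (t1 w ⟨hw.1.le, hw.2.le⟩).trans_le hs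
    have m2 := poly_anti (q.map ψ) (x := y') (y := x') fun w hw => by
      rw [← sign_nonpos_iff, derivative_map]
      exact ((t2 w ⟨hw.1.le, hw.2.le⟩).trans t3).trans_le hs
    have a1 : sg φ q y ≤ sg φ q x := SignType.sign.monotone
      (m1 (Set.left_mem_Icc.2 hxy.le) (Set.right_mem_Icc.2 hxy.le) hxy.le)
    have a2 : sg ψ q x' ≤ sg ψ q y' := SignType.sign.monotone
      (m2 (Set.left_mem_Icc.2 hcon) (Set.right_mem_Icc.2 hcon) hcon)
    rw [← hx q hq, ← hy q hq] at a2
    exact hqne (le_antisymm a2 a1)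

/-- pseudo-division -/
lemma prem_exists (q : R[X]) (hq : q.natDegree ≠ 0) : ∀ n, ∀ p : R[X], p.natDegree ≤ n →
    ∃ (N : ℕ) (a r : R[X]), C q.leadingCoeff ^ N * p = a * q + r ∧ r.natDegree < q.natDegree := by
  intro n
  induction n with
  | zero => intro p hp; exact ⟨0, 0, p, by simp, by omega⟩
  | succ n ih =>
    intro p hp
    by_cases hlt : p.natDegree < q.natDegree
    · exact ⟨0, 0, p, by simp, hlt⟩
    push Not at hlt
    have hp0 : p.natDegree ≠ 0 := by omega
    set p1 := C q.leadingCoeff * p - C p.leadingCoeff * X ^ (p.natDegree - q.natDegree) * q with hp1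
    have hle : p1.natDegree ≤ p.natDegree := by
      refine (natDegree_sub_le _ _).trans (max_le ?_ ?_)
      · exact natDegree_C_mul_le _ _
      · refine (natDegree_mul_le).trans ?_
        have := natDegree_C_mul_X_pow_le p.leadingCoeff (p.natDegree - q.natDegree)
        omega
    have hco : p1.coeff p.natDegree = 0 := by
      rw [hp1, coeff_sub, coeff_C_mul, mul_assoc, coeff_C_mul]
      have : (X ^ (p.natDegree - q.natDegree) * q).coeff p.natDegree = q.leadingCoeff := by
        rw [coeff_X_pow_mul', if_pos (by omega), Nat.sub_sub_self hlt]; rfl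
      rw [this]
      change q.leadingCoeff * p.leadingCoeff - p.leadingCoeff * q.leadingCoeff = 0
      ring
    have hlt1 : p1.natDegree < p.natDegree := by
      refine lt_of_le_of_ne hle fun h => ?_
      rw [← h] at hco
      have h2 : p1 = 0 := leadingCoeff_eq_zero.1 hco
      rw [h2, natDegree_zero] at h
      exact hp0 h.symm
    obtain ⟨N, a, r, h1, h2⟩ := ih p1 (by omega)
    refine ⟨N + 1, a + C q.leadingCoeff ^ N * (C p.leadingCoeff * X ^ (p.natDegree - q.natDegree)), r, ?_, h2⟩
    have : C q.leadingCoeff ^ (N + 1) * p = C q.leadingCoeff ^ N * p1 +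
      C q.leadingCoeff ^ N * (C p.leadingCoeff * X ^ (p.natDegree - q.natDegree)) * q := by
      rw [hp1]; ring
    rw [this, h1]; ring

/-- closure under the operations for divisor `q` -/
def ClAt (T : Set R[X]) (q : R[X]) : Prop :=
  derivative q ∈ T ∧ q.eraseLead ∈ T ∧ C q.leadingCoeff ∈ T ∧
    ∀ p ∈ T, q.natDegree ≤ p.natDegree → ∃ (N : ℕ) (a r : R[X]),
      C q.leadingCoeff ^ N * p = a * q + r ∧ r.natDegree < q.natDegree ∧ r ∈ T

lemma closure_exists : ∀ k : ℕ, ∀ T : Finset R[X],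
    (∀ q ∈ T, q.natDegree ≠ 0 → k ≤ q.natDegree → ClAt (T : Set R[X]) q) →
    ∃ F : Finset R[X], T ⊆ F ∧ ∀ q ∈ F, q.natDegree ≠ 0 → ClAt (F : Set R[X]) q := by
  classical
  intro k
  induction k with
  | zero => intro T hT; exact ⟨T, subset_rfl, fun q hq h0 => hT q hq h0 (Nat.zero_le _)⟩
  | succ k ih =>
    intro T hT
    by_cases hk : k = 0
    · refine ⟨T, subset_rfl, fun q hq h0 => hT q hq h0 (by omega)⟩
    have hprem : ∀ p q : R[X], ∃ r : R[X], q.natDegree ≠ 0 → ∃ (N : ℕ) (a : R[X]),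
        C q.leadingCoeff ^ N * p = a * q + r ∧ r.natDegree < q.natDegree := by
      intro p q
      by_cases h : q.natDegree = 0
      · exact ⟨0, fun h' => absurd h h'⟩
      · obtain ⟨N, a, r, h1, h2⟩ := prem_exists q h _ p le_rfl
        exact ⟨r, fun _ => ⟨N, a, h1, h2⟩⟩
    choose rem hrem using hprem
    let Tk := T.filter (fun q => q.natDegree = k)
    let T' : Finset R[X] := T ∪ (Tk.image derivative ∪ Tk.image eraseLead ∪
      Tk.image (fun q => C q.leadingCoeff) ∪ (T ×ˢ Tk).image (fun z => rem z.1 z.2))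
    have hnew : ∀ p ∈ T', p ∈ T ∨ p.natDegree < k := by
      intro p hp
      simp only [T', Finset.mem_union, Finset.mem_image, Finset.mem_product, Tk, Finset.mem_filter] at hp
      rcases hp with hp | (((⟨q, ⟨_, hq⟩, rfl⟩ | ⟨q, ⟨_, hq⟩, rfl⟩) | ⟨q, ⟨_, hq⟩, rfl⟩) | ⟨z, ⟨_, _, hq⟩, rfl⟩)
      · exact Or.inl hp
      · right; have := natDegree_derivative_lt (p := q) (by omega); omega
      · right; have := eraseLead_natDegree_le q; omega
      · right; rw [natDegree_C]; omega
      · right; obtain ⟨N, a, _, h⟩ := hrem z.1 z.2 (by omega); omega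
    have hTT' : T ⊆ T' := Finset.subset_union_left
    obtain ⟨F, hF, hF'⟩ := ih T' (by
      intro q hq h0 hkq
      have hqT : q ∈ T := (hnew q hq).resolve_right (by omega)
      rcases Nat.eq_or_lt_of_le hkq with h | h
      · have hqk : q ∈ Tk := by simp [Tk, hqT, h.symm]
        refine ⟨?_, ?_, ?_, ?_⟩
        · simp only [T', Finset.coe_union, Set.mem_union, Finset.mem_coe]
          right; left; left; left; exact Finset.mem_image_of_mem _ hqk
        · simp only [T', Finset.coe_union, Set.mem_union, Finset.mem_coe]
          right; left; left; right; exact Finset.mem_image_of_mem _ hqk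
        · simp only [T', Finset.coe_union, Set.mem_union, Finset.mem_coe]
          right; left; right; exact Finset.mem_image_of_mem (fun q => C q.leadingCoeff) hqk
        · intro p hp hpq
          have hpT : p ∈ T := (hnew p hp).resolve_right (by omega)
          obtain ⟨N, a, h1, h2⟩ := hrem p q h0
          refine ⟨N, a, rem p q, h1, h2, ?_⟩
          simp only [T', Finset.coe_union, Set.mem_union, Finset.mem_coe]
          right; right
          exact Finset.mem_image_of_mem (fun z : R[X] × R[X] => rem z.1 z.2)
            (Finset.mk_mem_product hpT hqk)
      · obtain ⟨h1, h2, h3, h4⟩ := hT q hqT h0 h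
        refine ⟨hTT' h1, hTT' h2, hTT' h3, ?_⟩
        intro p hp hpq
        have hpT : p ∈ T := (hnew p hp).resolve_right (by omega)
        obtain ⟨N, a, r, e1, e2, e3⟩ := h4 p hpT hpq
        exact ⟨N, a, r, e1, e2, hTT' e3⟩)
    exact ⟨F, hTT'.trans hF, hF'⟩

end ring
end SubHolder
end

section
open Filter Topology
namespace SubHolder
open Polynomial

section ring
variable {R : Type} [CommRing R]

/-- hypotheses for adding `p` to the family `D` -/
structure StepHyp (D : Set R[X]) (p : R[X]) (A B : R) : Prop where
  fin : D.Finite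
  memA : X - C A ∈ D
  memB : X - C B ∈ D
  dcl : DCl D
  dp : derivative p ∈ D
  er : ∀ q ∈ D, q.natDegree ≠ 0 → q.eraseLead ∈ D
  lc : ∀ q ∈ D, q.natDegree ≠ 0 → C q.leadingCoeff ∈ D
  rem : ∀ q ∈ D, q.natDegree ≠ 0 → ∃ (N : ℕ) (a r : R[X]), C q.leadingCoeff ^ N * p = a * q + r ∧ r ∈ D

def Match (D : Set R[X]) (A B : R) (φ ψ : R →+* ℝ) : Prop :=
  ∀ x ∈ Set.Icc (φ A) (φ B), ∃ x' ∈ Set.Icc (ψ A) (ψ B), Sim D φ ψ x x'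

lemma sg_eq_zero {φ : R →+* ℝ} {q : R[X]} {x : ℝ} : sg φ q x = 0 ↔ (q.map φ).eval x = 0 :=
  sign_eq_zero_iff

lemma step_root {D : Set R[X]} {p : R[X]} {A B : R} (H : StepHyp D p A B) {φ ψ : R →+* ℝ}
    {x x' : ℝ} (hs : Sim D φ ψ x x') :
    ∀ n, ∀ q ∈ D, q.natDegree ≤ n → q.map φ ≠ 0 → (q.map φ).eval x = 0 → sg φ p x = sg ψ p x' := by
  intro n
  induction n with
  | zero =>
    intro q hq hn hne h0
    exfalso
    have h1 : q.natDegree = 0 := by omega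
    obtain ⟨c, rfl⟩ := natDegree_eq_zero.1 h1
    rw [map_C, eval_C] at h0
    exact hne (by rw [map_C, h0, C_0])
  | succ n ih =>
    intro q hq hn hne h0
    by_cases h1 : q.natDegree = 0
    · exact ih q hq (by omega) hne h0
    by_cases hl : φ q.leadingCoeff = 0
    · have he : q.eraseLead.map φ = q.map φ := by
        conv_rhs => rw [← eraseLead_add_C_mul_X_pow q]
        rw [Polynomial.map_add, Polynomial.map_mul, map_C, hl]; simp
      refine ih _ (H.er q hq h1) ?_ (by rwa [he]) (by rwa [he])
      have := eraseLead_natDegree_le q; omega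
    · obtain ⟨N, a, r, hr, hrD⟩ := H.rem q hq h1
      have e1 : sg ψ q x' = 0 := by rw [← hs q hq, sg_eq_zero]; exact h0
      rw [sg_eq_zero] at e1
      have key : ∀ (χ : R →+* ℝ) (y : ℝ), (q.map χ).eval y = 0 →
          SignType.sign (χ q.leadingCoeff) ^ N * sg χ p y = sg χ r y := by
        intro χ y hy
        have := congrArg (fun P => (P.map χ).eval y) hr
        simp only [Polynomial.map_mul, Polynomial.map_pow, map_C, Polynomial.map_add, eval_mul,
          eval_pow, eval_C, eval_add, hy, mul_zero, zero_add] at this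
        rw [sg, sg, ← this, sign_mul, sign_pow]
      have k1 := key φ x h0
      have k2 := key ψ x' e1
      have hlc : SignType.sign (φ q.leadingCoeff) = SignType.sign (ψ q.leadingCoeff) := by
        have := hs _ (H.lc q hq h1)
        simpa [sg] using this
      rw [← hlc, ← hs r hrD, ← k1] at k2
      have hne' : SignType.sign (φ q.leadingCoeff) ^ N ≠ 0 := by
        apply pow_ne_zero; rwa [Ne, sign_eq_zero_iff]
      exact (mul_left_cancel₀ hne' k2).symm

lemma Sim.symm {D : Set R[X]} {φ ψ : R →+* ℝ} {x x' : ℝ} (h : Sim D φ ψ x x') : Sim D ψ φ x' x :=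
  fun q hq => (h q hq).symm

lemma Sim.trans {D : Set R[X]} {φ ψ χ : R →+* ℝ} {x y z : ℝ} (h : Sim D φ ψ x y) (h' : Sim D ψ χ y z) :
  Sim D φ χ x z := fun q hq => (h q hq).trans (h' q hq)

/-- the cell of a root is a point -/
lemma cell_point {D : Set R[X]} (hD : DCl D) {ψ : R →+* ℝ} {q : R[X]} (hq : q ∈ D)
    (hne : q.map ψ ≠ 0) {x y : ℝ} (hxy : x < y) (h0 : (q.map ψ).eval x = 0) : ¬ Sim D ψ ψ x y := by
  intro h
  have t := thom ψ hD h _ q hq le_rfl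
  apply hne
  refine Polynomial.eq_zero_of_infinite_isRoot _ ?_
  refine (Set.Icc_infinite hxy).mono ?_
  intro z hz
  have := t z hz
  rw [sg_eq_zero.2 h0, sg_eq_zero] at this
  exact this

/-- the cell of a root is a point, left version -/
lemma cell_point' {D : Set R[X]} (hD : DCl D) {ψ : R →+* ℝ} {q : R[X]} (hq : q ∈ D)
    (hne : q.map ψ ≠ 0) {x y : ℝ} (hxy : y < x) (h0 : (q.map ψ).eval x = 0) : ¬ Sim D ψ ψ x y := by
  intro h
  refine cell_point hD hq hne hxy ?_ h.symm
  have := h q hq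
  rw [sg_eq_zero.2 h0] at this
  exact sg_eq_zero.1 this.symm

lemma sign_const_Ioo (P : ℝ[X]) {a b x y : ℝ} (h : P ≠ 0 → ∀ z ∈ Set.Ioo a b, P.eval z ≠ 0)
    (hx : x ∈ Set.Ioo a b) (hy : y ∈ Set.Ioo a b) :
    SignType.sign (P.eval x) = SignType.sign (P.eval y) := by
  by_cases h0 : P = 0
  · simp [h0]
  have h := h h0
  have hiv := (isPreconnected_Ioo (a := a) (b := b)).intermediate_value hx hy
    (f := fun z => P.eval z) P.continuous.continuousOn
  have hiv' := (isPreconnected_Ioo (a := a) (b := b)).intermediate_value hy hx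
    (f := fun z => P.eval z) P.continuous.continuousOn
  rcases lt_or_gt_of_ne (h x hx) with h1 | h1 <;> rcases lt_or_gt_of_ne (h y hy) with h2 | h2
  · rw [sign_neg h1, sign_neg h2]
  · obtain ⟨z, hz, hz0⟩ := hiv ⟨h1.le, h2.le⟩
    exact absurd hz0 (h z hz)
  · obtain ⟨z, hz, hz0⟩ := hiv' ⟨h2.le, h1.le⟩
    exact absurd hz0 (h z hz)
  · rw [sign_pos h1, sign_pos h2]

/-- purely real final step -/
lemma real_step (P Q : ℝ[X]) {a b x a' b' : ℝ} (hx : x ∈ Set.Ioo a b) (hab' : a' < b')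
    (σ : SignType) (hP : ∀ z ∈ Set.Ioo a b, SignType.sign (P.derivative.eval z) = σ)
    (hQ : ∀ z ∈ Set.Ioo a' b', SignType.sign (Q.derivative.eval z) = σ)
    (ha : SignType.sign (P.eval a) = SignType.sign (Q.eval a'))
    (hb : SignType.sign (P.eval b) = SignType.sign (Q.eval b')) :
    ∃ x' ∈ Set.Ioo a' b', SignType.sign (P.eval x) = SignType.sign (Q.eval x') := by
  have hbt := poly_between P σ hP (z := x) ⟨hx.1.le, hx.2.le⟩
  have hfin : ∀ {U : Set ℝ}, IsOpen U → (Q.eval a' ∈ U ∨ Q.eval b' ∈ U) →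
      ∃ x' ∈ Set.Ioo a' b', Q.eval x' ∈ U := by
    intro U hU h
    have hop : IsOpen ((fun z => Q.eval z) ⁻¹' U) := hU.preimage Q.continuous
    rcases h with h | h
    · have h1 : ∀ᶠ z in 𝓝[>] a', Q.eval z ∈ U := nhdsWithin_le_nhds (hop.mem_nhds h)
      obtain ⟨z, hz, hz'⟩ := (h1.and (Ioo_mem_nhdsGT hab')).exists
      exact ⟨z, hz', hz⟩
    · have h1 : ∀ᶠ z in 𝓝[<] b', Q.eval z ∈ U := nhdsWithin_le_nhds (hop.mem_nhds h)
      obtain ⟨z, hz, hz'⟩ := (h1.and (Ioo_mem_nhdsLT hab')).exists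
      exact ⟨z, hz', hz⟩
  rcases lt_trichotomy (P.eval x) 0 with h | h | h
  · obtain ⟨z, hz, hz'⟩ := hfin (U := Set.Iio 0) isOpen_Iio (by
      rcases hbt with ⟨h1, h2⟩ | ⟨h1, h2⟩
      · left
        have : SignType.sign (Q.eval a') = -1 := by rw [← ha, sign_neg (h1.trans_lt h)]
        exact sign_eq_neg_one_iff.1 this
      · right
        have : SignType.sign (Q.eval b') = -1 := by rw [← hb, sign_neg (h1.trans_lt h)]
        exact sign_eq_neg_one_iff.1 this)
    exact ⟨z, hz, by rw [sign_neg h, sign_neg hz']⟩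
  · -- zero
    rw [h, sign_zero]
    have hIcc : x ∈ Set.Icc a b := ⟨hx.1.le, hx.2.le⟩
    have hab : a < b := hx.1.trans hx.2
    have hiff : (∃ z ∈ Set.Ioo a' b', Q.eval z = 0) → ∃ x' ∈ Set.Ioo a' b', (0 : SignType) = SignType.sign (Q.eval x') := by
      rintro ⟨z, hz, hz0⟩; exact ⟨z, hz, by rw [hz0, sign_zero]⟩
    apply hiff
    obtain hs | hs | hs := lt_trichotomy σ 0
    · have hs' : σ = -1 := by clear hP hQ; revert hs; revert σ; decide
      have m := strictAntiOn_of_deriv_neg (convex_Icc a b) P.continuous.continuousOn (by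
        intro z hz
        rw [interior_Icc] at hz
        rw [Polynomial.deriv]; exact sign_eq_neg_one_iff.1 ((hP z hz).trans hs'))
      have h1 : 0 < Q.eval a' := by
        apply sign_eq_one_iff.1; rw [← ha]; apply sign_pos
        rw [← h]; exact m (Set.left_mem_Icc.2 hab.le) hIcc hx.1
      have h2 : Q.eval b' < 0 := by
        apply sign_eq_neg_one_iff.1; rw [← hb]; apply sign_neg
        rw [← h]; exact m hIcc (Set.right_mem_Icc.2 hab.le) hx.2
      obtain ⟨z, hz, hz0⟩ := intermediate_value_Ioo' hab'.le (f := fun z => Q.eval z) Q.continuous.continuousOn ⟨h2, h1⟩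
      exact ⟨z, hz, hz0⟩
    · have e1 : P.eval a = 0 := by
        have m1 := poly_mono P (x := a) (y := b) fun z hz => by rw [← sign_nonneg_iff, hP z hz, hs]
        have m2 := poly_anti P (x := a) (y := b) fun z hz => by rw [← sign_nonpos_iff, hP z hz, hs]
        have i1 := m1 (Set.left_mem_Icc.2 hab.le) hIcc hx.1.le
        have i2 := m2 (Set.left_mem_Icc.2 hab.le) hIcc hx.1.le
        rw [← h]; exact le_antisymm i1 i2
      have e2 : Q.eval a' = 0 := by
        rw [e1, sign_zero] at ha; exact sign_eq_zero_iff.1 ha.symm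
      have m1 := poly_mono Q (x := a') (y := b') fun z hz => by rw [← sign_nonneg_iff, hQ z hz, hs]
      have m2 := poly_anti Q (x := a') (y := b') fun z hz => by rw [← sign_nonpos_iff, hQ z hz, hs]
      obtain ⟨z, hz1, hz2⟩ := exists_between hab'
      refine ⟨z, ⟨hz1, hz2⟩, ?_⟩
      have i1 := m1 (Set.left_mem_Icc.2 hab'.le) ⟨hz1.le, hz2.le⟩ hz1.le
      have i2 := m2 (Set.left_mem_Icc.2 hab'.le) ⟨hz1.le, hz2.le⟩ hz1.le
      rw [← e2]; exact le_antisymm i2 i1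
    · have hs' : σ = 1 := by clear hP hQ; revert hs; revert σ; decide
      have m := strictMonoOn_of_deriv_pos (convex_Icc a b) P.continuous.continuousOn (by
        intro z hz
        rw [interior_Icc] at hz
        rw [Polynomial.deriv]; exact sign_eq_one_iff.1 ((hP z hz).trans hs'))
      have h1 : Q.eval a' < 0 := by
        apply sign_eq_neg_one_iff.1; rw [← ha]; apply sign_neg
        rw [← h]; exact m (Set.left_mem_Icc.2 hab.le) hIcc hx.1
      have h2 : 0 < Q.eval b' := by
        apply sign_eq_one_iff.1; rw [← hb]; apply sign_pos
        rw [← h]; exact m hIcc (Set.right_mem_Icc.2 hab.le) hx.2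
      obtain ⟨z, hz, hz0⟩ := intermediate_value_Ioo hab'.le (f := fun z => Q.eval z) Q.continuous.continuousOn ⟨h1, h2⟩
      exact ⟨z, hz, hz0⟩
  · obtain ⟨z, hz, hz'⟩ := hfin (U := Set.Ioi 0) isOpen_Ioi (by
      rcases hbt with ⟨h1, h2⟩ | ⟨h1, h2⟩
      · right
        have : SignType.sign (Q.eval b') = 1 := by rw [← hb, sign_pos (h.trans_le h2)]
        exact sign_eq_one_iff.1 this
      · left
        have : SignType.sign (Q.eval a') = 1 := by rw [← ha, sign_pos (h.trans_le h2)]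
        exact sign_eq_one_iff.1 this)
    exact ⟨z, hz, by rw [sign_pos h, sign_pos hz']⟩

lemma step {D : Set R[X]} {p : R[X]} {A B : R} (H : StepHyp D p A B) {φ ψ : R →+* ℝ}
    (h1 : Match D A B φ ψ) (h2 : Match D A B ψ φ) : Match (insert p D) A B φ ψ := by
  classical
  intro x hx
  suffices h : ∃ x' ∈ Set.Icc (ψ A) (ψ B), Sim D φ ψ x x' ∧ sg φ p x = sg ψ p x' by
    obtain ⟨x', hx', hs, hp⟩ := h
    refine ⟨x', hx', ?_⟩
    rintro q (rfl | hq)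
    · exact hp
    · exact hs q hq
  by_cases hroot : ∃ q ∈ D, q.map φ ≠ 0 ∧ (q.map φ).eval x = 0
  · obtain ⟨q, hq, hne, h0⟩ := hroot
    obtain ⟨x', hx', hs⟩ := h1 x hx
    exact ⟨x', hx', hs, step_root H hs _ q hq le_rfl hne h0⟩
  push Not at hroot
  let Z : Set ℝ := ⋃ q ∈ D, {z | q.map φ ≠ 0 ∧ (q.map φ).eval z = 0}
  have hZ : Z.Finite := by
    refine H.fin.biUnion fun q _ => ?_
    by_cases h : q.map φ = 0
    · simp [h]
    · refine ((q.map φ).roots.toFinset.finite_toSet).subset ?_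
      intro z hz
      simp only [Finset.mem_coe, Multiset.mem_toFinset]
      rw [mem_roots h]; exact hz.2
  have memZ : ∀ z, z ∈ Z ↔ ∃ q ∈ D, q.map φ ≠ 0 ∧ (q.map φ).eval z = 0 := by
    intro z; simp only [Z, Set.mem_iUnion, exists_prop]; rfl
  have hxZ : x ∉ Z := by
    rw [memZ]; push Not; exact hroot
  have linZ : ∀ E : R, X - C E ∈ D → φ E ∈ Z := by
    intro E hE
    refine (memZ _).2 ⟨_, hE, ?_, by simp⟩
    rw [Polynomial.map_sub, map_X, map_C]; exact X_sub_C_ne_zero _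
  have hAZ := linZ A H.memA
  have hBZ := linZ B H.memB
  have hAx : φ A < x := lt_of_le_of_ne hx.1 fun h => hxZ (h ▸ hAZ)
  have hxB : x < φ B := lt_of_le_of_ne hx.2 fun h => hxZ (h ▸ hBZ)
  have fa : (Z ∩ Set.Iio x).Finite := hZ.subset Set.inter_subset_left
  have fb : (Z ∩ Set.Ioi x).Finite := hZ.subset Set.inter_subset_left
  obtain ⟨a0, ⟨ha0Z, ha0x⟩, ha0max⟩ := fa.exists_maximal ⟨φ A, hAZ, hAx⟩
  obtain ⟨b0, ⟨hb0Z, hb0x⟩, hb0min⟩ := fb.exists_minimal ⟨φ B, hBZ, hxB⟩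
  have hmax : ∀ z ∈ Z, z < x → z ≤ a0 := by
    intro z hz hzx
    rcases le_total z a0 with h | h
    · exact h
    · exact ha0max ⟨hz, hzx⟩ h
  have hmin : ∀ z ∈ Z, x < z → b0 ≤ z := by
    intro z hz hzx
    rcases le_total b0 z with h | h
    · exact h
    · exact hb0min ⟨hz, hzx⟩ h
  have ha0x : a0 < x := ha0x
  have hxb0 : x < b0 := hb0x
  have hAa0 : φ A ≤ a0 := hmax _ hAZ hAx
  have hb0B : b0 ≤ φ B := hmin _ hBZ hxB
  have hno : ∀ q ∈ D, q.map φ ≠ 0 → ∀ z ∈ Set.Ioo a0 b0, (q.map φ).eval z ≠ 0 := by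
    intro q hq hne z hz h0
    have hzZ : z ∈ Z := (memZ z).2 ⟨q, hq, hne, h0⟩
    rcases lt_trichotomy z x with h | h | h
    · exact absurd (hmax z hzZ h) (not_le.2 hz.1)
    · exact hxZ (h ▸ hzZ)
    · exact absurd (hmin z hzZ h) (not_le.2 hz.2)
  have hxI : x ∈ Set.Ioo a0 b0 := ⟨ha0x, hxb0⟩
  have hsim : ∀ y ∈ Set.Ioo a0 b0, Sim D φ φ x y := by
    intro y hy q hq
    exact sign_const_Ioo _ (hno q hq) hxI hy
  obtain ⟨qa, hqa, hqane, hqa0⟩ := (memZ _).1 ha0Z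
  obtain ⟨qb, hqb, hqbne, hqb0⟩ := (memZ _).1 hb0Z
  obtain ⟨a', ha', hsa⟩ := h1 a0 ⟨hAa0, ha0x.le.trans hx.2⟩
  obtain ⟨b', hb', hsb⟩ := h1 b0 ⟨hx.1.trans hxb0.le, hb0B⟩
  obtain ⟨x0', hx0', hsx⟩ := h1 x hx
  have hpa := step_root H hsa _ qa hqa le_rfl hqane hqa0
  have hpb := step_root H hsb _ qb hqb le_rfl hqbne hqb0
  have ha'x : a' < x0' := order_lemma H.dcl hsa hsx ha0x (fun h => by
    have := h qa hqa
    rw [sg_eq_zero.2 hqa0] at this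
    exact hroot qa hqa hqane (sg_eq_zero.1 this.symm))
  have hxb' : x0' < b' := order_lemma H.dcl hsx hsb hxb0 (fun h => by
    have := h qb hqb
    rw [sg_eq_zero.2 hqb0] at this
    exact hroot qb hqb hqbne (sg_eq_zero.1 this))
  have hqa0' : (qa.map ψ).eval a' = 0 := by
    have := hsa qa hqa
    rw [sg_eq_zero.2 hqa0] at this; exact sg_eq_zero.1 this.symm
  have hqb0' : (qb.map ψ).eval b' = 0 := by
    have := hsb qb hqb
    rw [sg_eq_zero.2 hqb0] at this; exact sg_eq_zero.1 this.symm
  have hψ : ∀ q ∈ D, q.map φ ≠ 0 → q.map ψ ≠ 0 := by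
    intro q hq hne h
    have := hsx q hq
    rw [sg, sg, h, eval_zero, sign_zero, sign_eq_zero_iff] at this
    exact hroot q hq hne this
  have hall : ∀ y' ∈ Set.Ioo a' b', Sim D φ ψ x y' := by
    intro y' hy'
    obtain ⟨y, hy, hsy⟩ := h2 y' ⟨ha'.1.trans hy'.1.le, hy'.2.le.trans hb'.2⟩
    have hay : ¬ Sim D φ φ y a0 := fun h =>
      cell_point H.dcl hqa (hψ qa hqa hqane) hy'.1 hqa0' (hsa.symm.trans (h.symm.trans hsy.symm))
    have hby : ¬ Sim D φ φ b0 y := fun h =>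
      cell_point' H.dcl hqb (hψ qb hqb hqbne) hy'.2 hqb0' (hsb.symm.trans (h.trans hsy.symm))
    have hya : a0 < y := by
      rcases lt_trichotomy a0 y with h | h | h
      · exact h
      · exact absurd (h ▸ fun q _ => rfl) hay
      · exact absurd (order_lemma H.dcl hsy.symm hsa h hay) (not_lt.2 hy'.1.le)
    have hyb : y < b0 := by
      rcases lt_trichotomy y b0 with h | h | h
      · exact h
      · exact absurd (h ▸ fun q _ => rfl) hby
      · exact absurd (order_lemma H.dcl hsb hsy.symm h hby) (not_lt.2 hy'.2.le)
    exact (hsim y ⟨hya, hyb⟩).trans hsy.symm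
  obtain ⟨x', hx', hp'⟩ := real_step (p.map φ) (p.map ψ) hxI (ha'x.trans hxb') (sg φ (derivative p) x)
    (fun z hz => by rw [derivative_map]; exact (hsim z hz _ H.dp).symm)
    (fun z hz => by rw [derivative_map]; exact (hall z hz _ H.dp).symm) hpa hpb
  exact ⟨x', ⟨ha'.1.trans hx'.1.le, hx'.2.le.trans hb'.2⟩, hall x' hx', hp'⟩

lemma match_all {F : Finset R[X]} {A B : R} (hA : X - C A ∈ F) (hB : X - C B ∈ F)
    (hF : ∀ q ∈ F, q.natDegree ≠ 0 → ClAt (F : Set R[X]) q) {φ ψ : R →+* ℝ} :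
    ∀ (n : ℕ) (G : Finset R[X]), G ⊆ F → X - C A ∈ G → X - C B ∈ G →
      (∀ q ∈ F, q.natDegree = 0 → q ∈ G) →
      (∀ q ∈ G, ∀ p ∈ F, p ∉ G → q.natDegree ≤ p.natDegree) → F.card = G.card + n →
      Match (G : Set R[X]) A B φ ψ → Match (G : Set R[X]) A B ψ φ →
      Match (F : Set R[X]) A B φ ψ := by
  classical
  intro n
  induction n with
  | zero =>
    intro G hGF _ _ _ _ hc h1 _
    rw [← Finset.eq_of_subset_of_card_le hGF (by omega)]; exact h1
  | succ n ih =>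
    intro G hGF hA' hB' h0 hinv hc h1 h2
    have hne : (F \ G).Nonempty := by
      rw [← Finset.card_pos, Finset.card_sdiff_of_subset hGF]; omega
    obtain ⟨p, hp, hpmin⟩ := Finset.exists_min_image (F \ G) natDegree hne
    rw [Finset.mem_sdiff] at hp
    have hp0 : p.natDegree ≠ 0 := fun h => hp.2 (h0 p hp.1 h)
    have hlow : ∀ r ∈ F, r.natDegree < p.natDegree → r ∈ G := by
      intro r hr hlt
      by_contra h
      have := hpmin r (Finset.mem_sdiff.2 ⟨hr, h⟩); omega
    have hlow' : ∀ q ∈ G, ∀ r ∈ F, r.natDegree < q.natDegree → r ∈ G := by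
      intro q hq r hr hlt
      by_contra h
      have := hinv q hq r hr h; omega
    have H : StepHyp (G : Set R[X]) p A B := by
      refine ⟨G.finite_toSet, hA', hB', ?_, ?_, ?_, ?_, ?_⟩
      · intro q hq hq0
        exact hlow' q hq _ (hF q (hGF hq) hq0).1 (natDegree_derivative_lt hq0)
      · exact hlow _ (hF p hp.1 hp0).1 (natDegree_derivative_lt hp0)
      · intro q hq hq0
        refine hlow' q hq _ (hF q (hGF hq) hq0).2.1 ?_
        have := eraseLead_natDegree_le q; omega
      · intro q hq hq0
        refine hlow' q hq _ (hF q (hGF hq) hq0).2.2.1 ?_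
        rw [natDegree_C]; omega
      · intro q hq hq0
        obtain ⟨N, a, r, e1, e2, e3⟩ := (hF q (hGF hq) hq0).2.2.2 p hp.1 (hinv q hq p hp.1 hp.2)
        exact ⟨N, a, r, e1, hlow' q hq r e3 e2⟩
    refine ih (insert p G) (Finset.insert_subset hp.1 hGF) (Finset.mem_insert_of_mem hA')
      (Finset.mem_insert_of_mem hB') (fun q hq h => Finset.mem_insert_of_mem (h0 q hq h)) ?_ ?_ ?_ ?_
    · intro q hq r hr hrn
      rw [Finset.mem_insert, not_or] at hrn
      rcases Finset.mem_insert.1 hq with rfl | hq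
      · exact hpmin r (Finset.mem_sdiff.2 ⟨hr, hrn.2⟩)
      · exact hinv q hq r hr hrn.2
    · rw [Finset.card_insert_of_notMem hp.2]; omega
    · rw [Finset.coe_insert]; exact step H h1 h2
    · rw [Finset.coe_insert]; exact step H h2 h1

theorem tqe (P : Finset R[X]) (A B : R) : ∃ S : Finset R, ∀ φ ψ : R →+* ℝ,
    φ A = ψ A → φ B = ψ B → (∀ s ∈ S, SignType.sign (φ s) = SignType.sign (ψ s)) →
    ∀ x ∈ Set.Icc (φ A) (φ B), ∃ x' ∈ Set.Icc (φ A) (φ B), ∀ p ∈ P,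
      SignType.sign ((p.map φ).eval x) = SignType.sign ((p.map ψ).eval x') := by
  classical
  let T : Finset R[X] := insert (X - C A) (insert (X - C B) P)
  obtain ⟨F, hTF, hF⟩ := closure_exists (T.sup natDegree + 1) T (by
    intro q hq _ h
    have := Finset.le_sup (f := natDegree) hq; omega)
  have hA : X - C A ∈ F := hTF (by simp [T])
  have hB : X - C B ∈ F := hTF (by simp [T])
  refine ⟨F.image (fun q => q.coeff 0), fun φ ψ hφA hφB hS => ?_⟩
  let G : Finset R[X] := F.filter (fun q => q.natDegree = 0 ∨ q = X - C A ∨ q = X - C B)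
  have base : ∀ x, Sim (G : Set R[X]) φ ψ x x := by
    intro x q hq
    simp only [G, Finset.coe_filter, Set.mem_ofPred_eq] at hq
    obtain ⟨hqF, h | rfl | rfl⟩ := hq
    · have := hS _ (Finset.mem_image_of_mem (fun q => q.coeff 0) hqF)
      obtain ⟨c, rfl⟩ := natDegree_eq_zero.1 h
      simpa [sg] using this
    · simp [sg, hφA]
    · simp [sg, hφB]
  have hM := match_all hA hB hF (φ := φ) (ψ := ψ) (F.card - G.card) G (Finset.filter_subset _ _)
    (by simp [G, hA]) (by simp [G, hB]) (fun q hq h => by simp [G, hq, h]) (by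
      intro q hq p hp hpG
      simp only [G, Finset.mem_filter, not_and, not_or] at hq hpG
      have h1 := (hpG hp).1
      have h2 : q.natDegree ≤ 1 := by
        obtain ⟨_, h | rfl | rfl⟩ := hq
        · omega
        · exact natDegree_X_sub_C_le _
        · exact natDegree_X_sub_C_le _
      omega)
    (by have := Finset.card_le_card (Finset.filter_subset (fun q : R[X] => q.natDegree = 0 ∨ q = X - C A ∨ q = X - C B) F)
        change F.card = G.card + (F.card - G.card)
        change G.card ≤ F.card at this
        omega)
    (fun x hx => ⟨x, by rwa [← hφA, ← hφB], base x⟩)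
    (fun x hx => ⟨x, by rwa [hφA, hφB], (base x).symm⟩)
  intro x hx
  obtain ⟨x', hx', hs⟩ := hM x hx
  refine ⟨x', by rwa [hφA, hφB], fun p hp => hs p (hTF ?_)⟩
  simp [T, hp]

end ring
end SubHolder
end

section
open Filter Topology
namespace SubHolder

/-! ### The filter of flat cusps -/

def cusp (k : ℕ) : Set (ℝ × ℝ) := {w | 0 < w.2 ∧ w.2 < 1 / ((k : ℝ) + 1) ∧ 0 < w.1 ∧ w.1 < w.2 ^ k}

def FF : Filter (ℝ × ℝ) := ⨅ k : ℕ, 𝓟 (cusp k)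

lemma cusp_anti : Antitone cusp := by
  intro k l hkl w hw
  have h0 : (0 : ℝ) < (k : ℝ) + 1 := by positivity
  have hkl' : (k : ℝ) ≤ l := by exact_mod_cast hkl
  have h1 : w.2 < 1 / ((k : ℝ) + 1) := hw.2.1.trans_le
    (one_div_le_one_div_of_le h0 (by linarith))
  have h2 : w.2 ≤ 1 := by
    refine h1.le.trans ?_
    rw [div_le_one h0]; have : (0 : ℝ) ≤ k := by positivity
    linarith
  exact ⟨hw.1, h1, hw.2.2.1, hw.2.2.2.trans_le (pow_le_pow_of_le_one hw.1.le h2 hkl)⟩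

lemma FF_iff {P : ℝ × ℝ → Prop} : (∀ᶠ w in FF, P w) ↔ ∃ k, ∀ w ∈ cusp k, P w := by
  have h : FF.HasBasis (fun _ : ℕ => True) cusp := by
    refine hasBasis_iInf_principal ?_
    exact cusp_anti.directed_ge
  rw [h.eventually_iff]; simp

lemma FF_pos : ∀ᶠ w in FF, 0 < w.1 ∧ 0 < w.2 := FF_iff.2 ⟨0, fun _ hw => ⟨hw.2.2.1, hw.1⟩⟩

lemma FF_le : FF ≤ 𝓝 (0 : ℝ × ℝ) := by
  intro U hU
  obtain ⟨ε, hε, h⟩ := Metric.mem_nhds_iff.1 hU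
  obtain ⟨k, hk⟩ := exists_nat_one_div_lt hε
  refine mem_of_superset (FF_iff.2 ⟨k + 1, fun w hw => hw⟩ : cusp (k + 1) ∈ FF) ?_
  intro w hw
  apply h
  have h1 := cusp_anti (Nat.le_succ k) hw
  have h2 : w.2 < ε := h1.2.1.trans hk
  have h3 := (cusp_anti (Nat.succ_le_succ (Nat.zero_le k)) hw).2.2.2
  have h4 : w.1 < w.2 := by simpa using h3
  rw [mem_ball_zero_iff, Prod.norm_def, max_lt_iff, Real.norm_eq_abs, Real.norm_eq_abs,
    abs_of_pos hw.2.2.1, abs_of_pos hw.1]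
  exact ⟨h4.trans h2, h2⟩

lemma FF_scale (K : ℕ) {P : ℝ × ℝ → Prop} (h : ∀ᶠ w in FF, P (w.2 ^ K * w.1, w.2)) :
    ∀ᶠ w in FF, P w := by
  obtain ⟨k, hk⟩ := FF_iff.1 h
  refine FF_iff.2 ⟨k + K, fun w hw => ?_⟩
  have hK : 0 < w.2 ^ K := pow_pos hw.1 K
  have := hk (w.1 / w.2 ^ K, w.2) ⟨hw.1, (cusp_anti (Nat.le_add_right k K) hw).2.1,
    div_pos hw.2.2.1 hK, by
      change w.1 / w.2 ^ K < w.2 ^ k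
      rw [div_lt_iff₀ hK, ← pow_add]; exact hw.2.2.2⟩
  simpa [mul_div_cancel₀ _ hK.ne'] using this

def Dec (P : ℝ × ℝ → Prop) : Prop := (∀ᶠ w in FF, P w) ∨ (∀ᶠ w in FF, ¬ P w)

lemma Dec.congr {P Q : ℝ × ℝ → Prop} (h : Dec P) (hPQ : ∀ᶠ w in FF, P w ↔ Q w) : Dec Q := by
  rcases h with h | h
  · left; filter_upwards [h, hPQ] with w h1 h2 using h2.1 h1
  · right; filter_upwards [h, hPQ] with w h1 h2 using fun h3 => h1 (h2.2 h3)

lemma Dec.const (p : Prop) : Dec (fun _ => p) := by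
  by_cases h : p
  · left; simp [h]
  · right; simp [h]

lemma Dec.and {P Q : ℝ × ℝ → Prop} (h : Dec P) (h' : Dec Q) : Dec (fun w => P w ∧ Q w) := by
  rcases h with h | h
  · rcases h' with h' | h'
    · left; filter_upwards [h, h'] with w h1 h2 using ⟨h1, h2⟩
    · right; filter_upwards [h'] with w h1 using fun h2 => h1 h2.2
  · right; filter_upwards [h] with w h1 using fun h2 => h1 h2.1

lemma Dec.exists {ι : Type} [Finite ι] {P : ι → ℝ × ℝ → Prop} (h : ∀ i, Dec (P i)) :
    Dec (fun w => ∃ i, P i w) := by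
  by_cases hex : ∃ i, ∀ᶠ w in FF, P i w
  · obtain ⟨i, hi⟩ := hex
    left; filter_upwards [hi] with w hw using ⟨i, hw⟩
  · right
    push Not at hex
    have : ∀ i, ∀ᶠ w in FF, ¬ P i w := fun i => (h i).resolve_left (by simpa using hex i)
    filter_upwards [eventually_all.2 this] with w hw
    push Not; exact hw

lemma Dec.forall {ι : Type} [Finite ι] {P : ι → ℝ × ℝ → Prop} (h : ∀ i, Dec (P i)) :
    Dec (fun w => ∀ i, P i w) := by
  by_cases hex : ∃ i, ∀ᶠ w in FF, ¬ P i w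
  · obtain ⟨i, hi⟩ := hex
    right; filter_upwards [hi] with w hw using fun h => hw (h i)
  · left
    push Not at hex
    have : ∀ i, ∀ᶠ w in FF, P i w := fun i => (h i).resolve_right (by simpa using hex i)
    filter_upwards [eventually_all.2 this] with w hw using hw

lemma Dec.scale (K : ℕ) {P : ℝ × ℝ → Prop} (h : Dec (fun w => P (w.2 ^ K * w.1, w.2))) : Dec P := by
  rcases h with h | h
  · exact Or.inl (FF_scale K h)
  · exact Or.inr (FF_scale K h)

lemma split_nhds {E : Type} [NormedAddCommGroup E] {p : ℝ × ℝ × E → Prop}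
    (h : ∀ᶠ z in 𝓝 0, p z) : ∃ M ∈ 𝓝 (0 : E), ∀ᶠ w in FF, ∀ y ∈ M, p (w.1, w.2, y) := by
  have ht : Tendsto (fun q : (ℝ × ℝ) × E => (q.1.1, q.1.2, q.2)) (𝓝 0 ×ˢ 𝓝 0) (𝓝 0) := by
    rw [← nhds_prod_eq]
    have hc : Continuous (fun q : (ℝ × ℝ) × E => (q.1.1, q.1.2, q.2)) := by fun_prop
    simpa [Prod.mk_zero_zero] using hc.tendsto (0, 0)
  obtain ⟨pa, ha, pb, hb, hab⟩ := eventually_prod_iff.1 (ht.eventually h)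
  exact ⟨{y | pb y}, hb, by
    filter_upwards [FF_le ha] with w hw y hy using hab hw hy⟩

/-! ### Generic directions -/

lemma generic_open {E ι : Type} [NormedAddCommGroup E] [NormedSpace ℝ E] {δ : ℝ}
    (g : ι → E → ℝ) (hg : ∀ i, ∀ x ∈ Metric.ball (0 : E) δ, AnalyticAt ℝ (g i) x)
    (hne : ∀ i, ¬ ∀ᶠ x in 𝓝 (0 : E), g i x = 0) (T : Finset ι) (O : Set E) (hO : IsOpen O)
    (hOn : O.Nonempty) (hOδ : O ⊆ Metric.ball 0 δ) :
    ∃ O' ⊆ O, IsOpen O' ∧ O'.Nonempty ∧ ∀ i ∈ T, ∀ x ∈ O', g i x ≠ 0 := by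
  classical
  induction T using Finset.induction_on with
  | empty => exact ⟨O, subset_rfl, hO, hOn, by simp⟩
  | insert i T hi ih =>
    obtain ⟨O', hO'O, hO', hO'n, h⟩ := ih
    have hex : ∃ x ∈ O', g i x ≠ 0 := by
      by_contra hcon
      push Not at hcon
      obtain ⟨x0, hx0⟩ := hO'n
      have hA : AnalyticOnNhd ℝ (g i) (Metric.ball 0 δ) := hg i
      have hx0δ := hOδ (hO'O hx0)
      have hz := hA.eqOn_zero_of_preconnected_of_eventuallyEq_zero
        (convex_ball (0 : E) δ).isPreconnected hx0δ
        (by filter_upwards [hO'.mem_nhds hx0] with x hx using hcon x hx)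
      apply hne i
      have hδ : 0 < δ := Metric.pos_of_mem_ball hx0δ
      filter_upwards [Metric.ball_mem_nhds (0 : E) hδ] with x hx using hz hx
    obtain ⟨x0, hx0, hx0'⟩ := hex
    have hc : ContinuousOn (g i) O' := fun x hx =>
      ((hg i x (hOδ (hO'O hx))).continuousAt).continuousWithinAt
    refine ⟨O' ∩ (g i) ⁻¹' {0}ᶜ, Set.inter_subset_left.trans hO'O,
      hc.isOpen_inter_preimage hO' isOpen_compl_singleton, ⟨x0, hx0, hx0'⟩, ?_⟩
    intro j hj x hx
    rcases Finset.mem_insert.1 hj with rfl | hj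
    · exact hx.2
    · exact h j hj x hx.1

lemma generic_dir {E ι : Type} [NormedAddCommGroup E] [NormedSpace ℝ E] [Nontrivial E] [Finite ι]
    (g : ι → E → ℝ) (hg : ∀ i, AnalyticAt ℝ (g i) 0)
    (hne : ∀ i, ¬ ∀ᶠ x in 𝓝 (0 : E), g i x = 0) :
    ∃ v : E, v ≠ 0 ∧ ∀ i, ¬ ∀ᶠ c in 𝓝 (0 : ℝ), g i (c • v) = 0 := by
  classical
  have := Fintype.ofFinite ι
  have h1 : ∀ᶠ x in 𝓝 (0 : E), ∀ i, AnalyticAt ℝ (g i) x :=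
    eventually_all.2 fun i => (hg i).eventually_analyticAt
  obtain ⟨δ, hδ, hball⟩ := Metric.eventually_nhds_iff.1 h1
  have hball' : ∀ x ∈ Metric.ball (0 : E) δ, ∀ i, AnalyticAt ℝ (g i) x := fun x hx => hball hx
  obtain ⟨w, hw, hwδ⟩ : ∃ w : E, w ≠ 0 ∧ w ∈ Metric.ball (0 : E) δ := by
    obtain ⟨w, hw⟩ := exists_norm_eq E (c := δ / 2) (by positivity)
    refine ⟨w, fun h => ?_, ?_⟩
    · rw [h, norm_zero] at hw; linarith
    · rw [mem_ball_zero_iff, hw]; linarith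
  obtain ⟨O', hO', _, ⟨v, hv⟩, hgO⟩ := generic_open g (fun i x hx => hball' x hx i) hne Finset.univ
    (Metric.ball 0 δ \ {0}) (Metric.isOpen_ball.sdiff isClosed_singleton) ⟨w, hwδ, hw⟩ Set.sdiff_subset
  have hv0 : v ≠ 0 := (hO' hv).2
  have hvδ : ‖v‖ < δ := mem_ball_zero_iff.1 (hO' hv).1
  refine ⟨v, hv0, fun i hcon => ?_⟩
  have hvn : 0 < ‖v‖ := norm_pos_iff.2 hv0
  have := zero_on_ball (φ := fun c : ℝ => g i (c • v)) (δ := δ / ‖v‖) (by positivity) ?_ hcon 1 ?_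
  · rw [one_smul] at this
    exact hgO i (Finset.mem_univ i) v hv this
  · intro c hc
    refine AnalyticAt.fun_comp (f := fun c : ℝ => c • v) (g := g i) (hball' _ ?_ i) (by fun_prop)
    rw [mem_ball_zero_iff, norm_smul]
    rw [mem_ball_zero_iff, lt_div_iff₀ hvn] at hc
    exact hc
  · rw [mem_ball_zero_iff, lt_div_iff₀ hvn]; simpa using hvδ

end SubHolder
end

section
open Filter Topology
namespace SubHolder

abbrev GG (n : ℕ) := ℝ × ℝ × (Fin n → ℝ)

/-- germs of analytic functions (honest functions, analytic at `0`) -/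
def AR (n : ℕ) : Subring (GG n → ℝ) where
  carrier := {f | AnalyticAt ℝ f 0}
  mul_mem' := fun h h' => AnalyticAt.mul h h'
  one_mem' := analyticAt_const
  add_mem' := fun h h' => AnalyticAt.add h h'
  zero_mem' := analyticAt_const
  neg_mem' := fun h => AnalyticAt.neg h

def evR {n : ℕ} (g : GG n) : AR n →+* ℝ := (Pi.evalRingHom (fun _ : GG n => ℝ) g).comp (AR n).subtype

lemma evR_apply {n : ℕ} (g : GG n) (a : AR n) : evR g a = a.1 g := rfl

def LocalProp (n : ℕ) (ι : Type) (f : ι → GG n → ℝ) : Prop :=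
  ∀ M ∈ 𝓝 (0 : Fin n → ℝ), ∃ N ⊆ M, N ∈ 𝓝 0 ∧ ∀ σ : ι → SignType,
    Dec (fun w : ℝ × ℝ => ∃ y ∈ N, ∀ i, SignType.sign (f i (w.1, w.2, y)) = σ i)

def Reg {n : ℕ} (F : GG n → ℝ) : Prop := F = 0 ∨ ¬ ∀ᶠ y in 𝓝 (0 : Fin n → ℝ), F (0, 0, y) = 0

lemma local_of_reg {n : ℕ} {ι : Type} [Finite ι]
    (H : ∀ F : ι → GG n → ℝ, (∀ i, AnalyticAt ℝ (F i) 0) → (∀ i, Reg (F i)) → LocalProp n ι F)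
    (f : ι → GG n → ℝ) (hf : ∀ i, AnalyticAt ℝ (f i) 0) : LocalProp n ι f := by
  have := Fintype.ofFinite ι
  intro M hM
  choose e he using fun i => normal_form (f i) (hf i)
  let K := Finset.univ.sup e
  choose F hF hreg hs using fun i => he i K (Finset.le_sup (Finset.mem_univ i))
  obtain ⟨M1, hM1, hev⟩ := split_nhds (eventually_all.2 hs)
  obtain ⟨N, hN, hN0, hdec⟩ := H F hF hreg (M ∩ M1) (inter_mem hM hM1)
  refine ⟨N, hN.trans Set.inter_subset_left, hN0, fun σ => Dec.scale K ?_⟩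
  refine (hdec σ).congr ?_
  filter_upwards [hev, FF_pos] with w h1 h2
  refine exists_congr fun y => and_congr_right fun hy => forall_congr' fun i => ?_
  rw [← h1 y (hN hy).2 i h2.1 h2.2]

lemma local_zero {ι : Type} [Finite ι] (F : ι → GG 0 → ℝ) (hF : ∀ i, AnalyticAt ℝ (F i) 0)
    (hreg : ∀ i, Reg (F i)) : LocalProp 0 ι F := by
  intro M hM
  refine ⟨M, subset_rfl, hM, fun σ => ?_⟩
  have h : Dec (fun w : ℝ × ℝ => ∀ i, SignType.sign (F i (w.1, w.2, 0)) = σ i) := by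
    refine Dec.forall fun i => ?_
    rcases hreg i with h | h
    · rw [h]; exact Dec.const (SignType.sign (0 : ℝ) = σ i)
    · have h0 : F i 0 ≠ 0 := by
        intro h0
        apply h
        refine Eventually.of_forall fun y => ?_
        rw [Subsingleton.elim y 0]; exact h0
      have hc : Tendsto (fun w : ℝ × ℝ => F i (w.1, w.2, 0)) FF (𝓝 (F i 0)) := by
        have h1 : Tendsto (fun w : ℝ × ℝ => ((w.1, w.2, 0) : GG 0)) (𝓝 0) (𝓝 0) := by
          have hc : Continuous (fun w : ℝ × ℝ => ((w.1, w.2, 0) : GG 0)) := by fun_prop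
          exact hc.tendsto 0
        exact (hF i).continuousAt.tendsto.comp (h1.mono_left FF_le)
      rcases lt_or_gt_of_ne h0 with h1 | h1
      · refine (Dec.const (-1 = σ i)).congr ?_
        filter_upwards [hc.eventually (gt_mem_nhds h1)] with w hw
        rw [sign_neg hw]
      · refine (Dec.const (1 = σ i)).congr ?_
        filter_upwards [hc.eventually (lt_mem_nhds h1)] with w hw
        rw [sign_pos hw]
  refine h.congr (Eventually.of_forall fun w => ?_)
  constructor
  · intro h; exact ⟨0, mem_of_mem_nhds hM, h⟩
  · rintro ⟨y, _, h⟩; rwa [Subsingleton.elim y 0] at h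

lemma exists_L {n : ℕ} {v : Fin (n + 1) → ℝ} (hv : v ≠ 0) :
    ∃ L : (ℝ × (Fin n → ℝ)) ≃L[ℝ] (Fin (n + 1) → ℝ), L (1, 0) = v := by
  let L0 : (ℝ × (Fin n → ℝ)) ≃L[ℝ] (Fin (n + 1) → ℝ) := Fin.consEquivL ℝ (fun _ => ℝ)
  have h1 : L0 (1, 0) ≠ 0 := by
    rw [Ne, map_eq_zero_iff _ L0.injective]
    intro h; exact one_ne_zero (congrArg Prod.fst h)
  obtain ⟨A, hA⟩ := SeparatingDual.exists_continuousLinearEquiv_apply_eq (R := ℝ) h1 hv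
  exact ⟨L0.trans A, hA⟩

lemma local_succ {n : ℕ} (IH : ∀ (ι : Type) [Finite ι] (f : ι → GG n → ℝ),
    (∀ i, AnalyticAt ℝ (f i) 0) → LocalProp n ι f) {ι : Type} [Finite ι]
    (F : ι → GG (n + 1) → ℝ) (hF : ∀ i, AnalyticAt ℝ (F i) 0)
    (hreg : ∀ i, Reg (F i)) : LocalProp (n + 1) ι F := by
  classical
  have := Fintype.ofFinite ι
  intro M hM
  -- generic direction
  obtain ⟨v, hv0, hv⟩ := generic_dir (ι := {i // F i ≠ 0})
    (fun i (y : Fin (n + 1) → ℝ) => F i.1 (0, 0, y)) (fun i => by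
      refine AnalyticAt.fun_comp (g := F i.1) (f := fun y : Fin (n + 1) → ℝ => ((0, 0, y) : GG (n + 1)))
        (hF i.1) (by fun_prop)) (fun i => (hreg i.1).resolve_left i.2)
  obtain ⟨L, hL⟩ := exists_L hv0
  -- Weierstrass
  have hmap : AnalyticAt ℝ (fun z : ℝ × GG n => ((z.2.1, z.2.2.1, L (z.1, z.2.2.2)) : GG (n + 1))) 0 := by
    have a1 : AnalyticAt ℝ (fun z : ℝ × GG n => z.2) 0 := analyticAt_snd
    have a2 : AnalyticAt ℝ (fun z : ℝ × GG n => z.2.1) 0 :=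
      AnalyticAt.fun_comp (f := fun z : ℝ × GG n => z.2) (g := fun w : GG n => w.1) analyticAt_fst a1
    have a3 : AnalyticAt ℝ (fun z : ℝ × GG n => z.2.2.1) 0 :=
      AnalyticAt.fun_comp (f := fun z : ℝ × GG n => z.2) (g := fun w : GG n => w.2.1) (an_t _) a1
    have a4 : AnalyticAt ℝ (fun z : ℝ × GG n => z.2.2.2) 0 :=
      AnalyticAt.fun_comp (f := fun z : ℝ × GG n => z.2) (g := fun w : GG n => w.2.2) (an_y _) a1
    have a0 : AnalyticAt ℝ (fun z : ℝ × GG n => z.1) 0 := analyticAt_fst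
    refine a2.prod (a3.prod ?_)
    exact AnalyticAt.fun_comp (f := fun z : ℝ × GG n => (z.1, z.2.2.2)) (g := fun w => L w)
      (L.toContinuousLinearMap.analyticAt _) (a0.prod a4)
  have hmap0 : (fun z : ℝ × GG n => ((z.2.1, z.2.2.1, L (z.1, z.2.2.2)) : GG (n + 1))) 0 = 0 := by
    simp [Prod.mk_zero_zero]
  have hW : ∀ i, ∃ (d : ℕ) (a : ℕ → GG n → ℝ) (c : SignType), (∀ j, AnalyticAt ℝ (a j) 0) ∧
      ∀ᶠ z in 𝓝 (0 : ℝ × GG n), SignType.sign (F i (z.2.1, z.2.2.1, L (z.1, z.2.2.2))) =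
        c * SignType.sign (∑ j ∈ Finset.range (d + 1), a j z.2 * z.1 ^ j) := by
    intro i
    by_cases h0 : F i = 0
    · refine ⟨0, fun _ _ => 0, 0, fun _ => analyticAt_const, Eventually.of_forall fun z => ?_⟩
      rw [h0]; simp
    · refine weier (fun z : ℝ × GG n => F i (z.2.1, z.2.2.1, L (z.1, z.2.2.2))) ?_ ?_
      · exact AnalyticAt.fun_comp (g := F i) (by
          have h := hF i
          rw [← hmap0] at h; exact h) hmap
      · intro hcon
        apply hv ⟨i, h0⟩
        filter_upwards [hcon] with c hc
        rw [← hL, ← map_smul]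
        simpa using hc
  choose d a c ha hsgn using hW
  -- neighbourhoods
  have hLM : ∀ᶠ z in 𝓝 (0 : ℝ × (Fin n → ℝ)), L z ∈ M := by
    have := L.continuous.tendsto 0
    rw [map_zero] at this
    exact this.eventually hM
  have hLM' : ∀ᶠ z in 𝓝 (0 : ℝ × GG n), L (z.1, z.2.2.2) ∈ M := by
    have hc : Continuous (fun z : ℝ × GG n => (z.1, z.2.2.2)) := by fun_prop
    have ht : Tendsto (fun z : ℝ × GG n => (z.1, z.2.2.2)) (𝓝 0) (𝓝 0) := by
      simpa [Prod.mk_zero_zero] using hc.tendsto 0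
    exact ht.eventually hLM
  have hall := (eventually_all.2 hsgn).and hLM'
  rw [← Prod.mk_zero_zero, nhds_prod_eq] at hall
  obtain ⟨pa, hpa, pb, hpb, hab⟩ := eventually_prod_iff.1 hall
  obtain ⟨δ, hδ, hδpa⟩ := Metric.nhds_basis_closedBall.eventually_iff.1 hpa
  have hδ' : ∀ x ∈ Set.Icc (-δ) δ, pa x := by
    intro x hx
    apply hδpa
    rw [mem_closedBall_zero_iff, Real.norm_eq_abs, abs_le]; exact hx
  obtain ⟨M1, hM1, hevM⟩ := split_nhds hpb
  have hpbM : ∃ M2 ∈ 𝓝 (0 : Fin n → ℝ), ∀ x ∈ M2, ∀ c ∈ Set.Icc (-δ) δ, L (c, x) ∈ M := by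
    have hc : Continuous (fun x : Fin n → ℝ => ((0, 0, x) : GG n)) := by fun_prop
    have ht : Tendsto (fun x : Fin n → ℝ => ((0, 0, x) : GG n)) (𝓝 0) (𝓝 0) := by
      simpa [Prod.mk_zero_zero] using hc.tendsto 0
    refine ⟨_, ht.eventually hpb, fun x hx c hc => ?_⟩
    exact (hab (hδ' c hc) hx).2
  obtain ⟨M2, hM2, hM2'⟩ := hpbM
  -- polynomials
  let A : AR n := ⟨fun _ => -δ, analyticAt_const⟩
  let B : AR n := ⟨fun _ => δ, analyticAt_const⟩
  let p : ι → Polynomial (AR n) := fun i => ∑ j ∈ Finset.range (d i + 1),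
    Polynomial.C (⟨a i j, ha i j⟩ : AR n) * Polynomial.X ^ j
  have hp : ∀ i g x, ((p i).map (evR g)).eval x = ∑ j ∈ Finset.range (d i + 1), a i j g * x ^ j := by
    intro i g x
    simp only [p, Polynomial.map_sum, Polynomial.map_mul, Polynomial.map_C, Polynomial.map_pow,
      Polynomial.map_X, Polynomial.eval_finsetSum, Polynomial.eval_mul, Polynomial.eval_C,
      Polynomial.eval_pow, Polynomial.eval_X, evR_apply]
  obtain ⟨S, hS⟩ := tqe (Finset.univ.image p) A B
  obtain ⟨N', hN', hN'0, hdec⟩ := IH S (fun s => s.1.1) (fun s => s.1.2) (M1 ∩ M2) (inter_mem hM1 hM2)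
  refine ⟨L '' (Set.Icc (-δ) δ ×ˢ N'), ?_, ?_, ?_⟩
  · rintro _ ⟨⟨c, x⟩, ⟨hc, hx⟩, rfl⟩
    exact hM2' x (hN' hx).2 c hc
  · have h1 : (Set.Icc (-δ) δ ×ˢ N') ∈ 𝓝 (0 : ℝ × (Fin n → ℝ)) := by
      rw [← Prod.mk_zero_zero]
      exact prod_mem_nhds (Icc_mem_nhds (by linarith) hδ) hN'0
    have := L.toHomeomorph.isOpenMap.image_mem_nhds h1
    simpa using this
  · intro σ
    let good : (S → SignType) → Prop := fun τ => ∃ g : GG n, (∀ s : S, SignType.sign (s.1.1 g) = τ s) ∧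
      ∃ x ∈ Set.Icc (-δ) δ, ∀ i, c i * SignType.sign (((p i).map (evR g)).eval x) = σ i
    have hD : Dec (fun w : ℝ × ℝ => ∃ τ : S → SignType, good τ ∧
        ∃ x ∈ N', ∀ s : S, SignType.sign (s.1.1 (w.1, w.2, x)) = τ s) :=
      Dec.exists fun τ => (Dec.const _).and (hdec τ)
    refine hD.congr ?_
    filter_upwards [hevM] with w hw
    have key : ∀ x ∈ N', ∀ y ∈ Set.Icc (-δ) δ, ∀ i, SignType.sign (F i (w.1, w.2, L (y, x))) =
        c i * SignType.sign (((p i).map (evR ((w.1, w.2, x) : GG n))).eval y) := by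
      intro x hx y hy i
      rw [hp]
      exact (hab (hδ' y hy) (hw x (hN' hx).1)).1 i
    constructor
    · rintro ⟨τ, ⟨g, hg, y, hy, hyσ⟩, x, hx, hxτ⟩
      obtain ⟨y', hy', hs⟩ := hS (evR g) (evR ((w.1, w.2, x) : GG n)) rfl rfl (fun s hs => by
        rw [evR_apply, evR_apply]
        exact (hg ⟨s, hs⟩).trans (hxτ ⟨s, hs⟩).symm) y hy
      refine ⟨L (y', x), ⟨(y', x), ⟨hy', hx⟩, rfl⟩, fun i => ?_⟩
      rw [key x hx y' hy' i, ← hs (p i) (Finset.mem_image_of_mem p (Finset.mem_univ i)), hyσ i]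
    · rintro ⟨_, ⟨⟨y, x⟩, ⟨hy, hx⟩, rfl⟩, h⟩
      refine ⟨fun s => SignType.sign (s.1.1 (w.1, w.2, x)), ⟨(w.1, w.2, x), fun s => rfl, y, hy, fun i => ?_⟩,
        x, hx, fun s => rfl⟩
      rw [← key x hx y hy i]; exact h i

theorem local_main (n : ℕ) : ∀ (ι : Type) [Finite ι] (f : ι → GG n → ℝ),
    (∀ i, AnalyticAt ℝ (f i) 0) → LocalProp n ι f := by
  induction n with
  | zero => intro ι _ f hf; exact local_of_reg local_zero f hf
  | succ n ih => intro ι _ f hf; exact local_of_reg (local_succ ih) f hf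

end SubHolder
end

section
open Filter Topology
namespace SubHolder

/-! ### Global decidability on compact sets -/

section
variable {Z : Type} [NormedAddCommGroup Z] [NormedSpace ℝ Z]

/-- `Q` is locally at `(0,0,q)` described by signs of finitely many analytic functions. -/
def LD (q : Z) (Q : ℝ × ℝ × Z → Prop) : Prop :=
  ∃ (ι : Type) (_ : Finite ι) (f : ι → ℝ × ℝ × Z → ℝ) (T : Set (ι → SignType)),
    (∀ i, AnalyticAt ℝ (f i) (0, 0, q)) ∧
    ∀ᶠ z in 𝓝 ((0, 0, q) : ℝ × ℝ × Z), (Q z ↔ (fun i => SignType.sign (f i z)) ∈ T)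

lemma LD.congr {q : Z} {Q Q' : ℝ × ℝ × Z → Prop} (h : LD q Q)
    (h' : ∀ᶠ z in 𝓝 ((0, 0, q) : ℝ × ℝ × Z), Q z ↔ Q' z) : LD q Q' := by
  obtain ⟨ι, hι, f, T, hf, he⟩ := h
  refine ⟨ι, hι, f, T, hf, ?_⟩
  filter_upwards [he, h'] with z h1 h2
  rw [← h2, h1]

lemma LD.base {q : Z} {f : ℝ × ℝ × Z → ℝ} (hf : AnalyticAt ℝ f (0, 0, q)) (T : Set SignType) :
    LD q (fun z => SignType.sign (f z) ∈ T) :=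
  ⟨Unit, inferInstance, fun _ => f, {τ | τ () ∈ T}, fun _ => hf, Eventually.of_forall fun _ => Iff.rfl⟩

lemma LD.nonneg {q : Z} {f : ℝ × ℝ × Z → ℝ} (hf : AnalyticAt ℝ f (0, 0, q)) :
    LD q (fun z => 0 ≤ f z) :=
  (LD.base hf {τ | 0 ≤ τ}).congr (Eventually.of_forall fun _ => sign_nonneg_iff)

lemma LD.pos {q : Z} {f : ℝ × ℝ × Z → ℝ} (hf : AnalyticAt ℝ f (0, 0, q)) :
    LD q (fun z => 0 < f z) :=
  (LD.base hf {τ | τ = 1}).congr (Eventually.of_forall fun _ => sign_eq_one_iff)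

lemma LD.zero {q : Z} {f : ℝ × ℝ × Z → ℝ} (hf : AnalyticAt ℝ f (0, 0, q)) :
    LD q (fun z => f z = 0) :=
  (LD.base hf {τ | τ = 0}).congr (Eventually.of_forall fun _ => sign_eq_zero_iff)

lemma LD.not {q : Z} {Q : ℝ × ℝ × Z → Prop} (h : LD q Q) : LD q (fun z => ¬ Q z) := by
  obtain ⟨ι, hι, f, T, hf, he⟩ := h
  refine ⟨ι, hι, f, Tᶜ, hf, ?_⟩
  filter_upwards [he] with z h1
  rw [h1]; rfl

lemma LD.forall {q : Z} {κ : Type} [Finite κ] {Q : κ → ℝ × ℝ × Z → Prop} (h : ∀ k, LD q (Q k)) :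
    LD q (fun z => ∀ k, Q k z) := by
  choose ι hι f T hf he using h
  refine ⟨Σ k, ι k, inferInstance, fun s => f s.1 s.2,
    {τ | ∀ k, (fun i => τ ⟨k, i⟩) ∈ T k}, fun s => hf _ _, ?_⟩
  filter_upwards [eventually_all.2 he] with z hz
  exact forall_congr' fun k => hz k

lemma LD.exists {q : Z} {κ : Type} [Finite κ] {Q : κ → ℝ × ℝ × Z → Prop} (h : ∀ k, LD q (Q k)) :
    LD q (fun z => ∃ k, Q k z) :=
  (LD.not (LD.forall fun k => (h k).not)).congr (Eventually.of_forall fun z => by push Not; rfl)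

lemma LD.and {q : Z} {Q Q' : ℝ × ℝ × Z → Prop} (h : LD q Q) (h' : LD q Q') :
    LD q (fun z => Q z ∧ Q' z) := by
  have := LD.forall (κ := Bool) (Q := fun k => if k then Q else Q') (q := q)
    (fun k => by cases k <;> simpa)
  refine this.congr (Eventually.of_forall fun z => ?_)
  simp [and_comm]

lemma local_dec [FiniteDimensional ℝ Z] {q : Z} {Q : ℝ × ℝ × Z → Prop} (h : LD q Q) :
    ∃ V ∈ 𝓝 q, Dec (fun w => ∃ z ∈ V, Q (w.1, w.2, z)) := by
  obtain ⟨ι, hι, f, T, hf, he⟩ := h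
  let e : (Fin (Module.finrank ℝ Z) → ℝ) ≃L[ℝ] Z := ContinuousLinearEquiv.ofFinrankEq (by simp)
  let n := Module.finrank ℝ Z
  let Ψ : GG n → ℝ × ℝ × Z := fun z => (z.1, z.2.1, q + e z.2.2)
  have hΨ0 : Ψ 0 = (0, 0, q) := by simp [Ψ]
  have hΨ : AnalyticAt ℝ Ψ 0 := by
    refine AnalyticAt.prod analyticAt_fst ((an_t _).prod (analyticAt_const.add ?_))
    exact AnalyticAt.fun_comp (f := fun z : GG n => z.2.2) (g := fun y => e y)
      (e.toContinuousLinearMap.analyticAt _) (an_y _)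
  have hΨt : Tendsto Ψ (𝓝 0) (𝓝 (0, 0, q)) := by
    have := hΨ.continuousAt.tendsto; rwa [hΨ0] at this
  obtain ⟨M, hM, hev⟩ := split_nhds (hΨt.eventually he)
  obtain ⟨N, hN, hN0, hdec⟩ := local_main n ι (fun i z => f i (Ψ z))
    (fun i => AnalyticAt.fun_comp (g := f i) (f := Ψ) (by rw [hΨ0]; exact hf i) hΨ) M hM
  refine ⟨(fun y => q + e y) '' N, ?_, ?_⟩
  · have := (e.toHomeomorph.trans (Homeomorph.addLeft q)).isOpenMap.image_mem_nhds hN0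
    have h0 : (e.toHomeomorph.trans (Homeomorph.addLeft q)) 0 = q := by
      change q + e 0 = q
      simp
    rw [h0] at this
    exact this
  · have hD : Dec (fun w : ℝ × ℝ => ∃ τ : ι → SignType, τ ∈ T ∧
        ∃ y ∈ N, ∀ i, SignType.sign (f i (Ψ (w.1, w.2, y))) = τ i) :=
      Dec.exists fun τ => (Dec.const _).and (hdec τ)
    refine hD.congr ?_
    filter_upwards [hev] with w hw
    constructor
    · rintro ⟨τ, hτ, y, hy, h⟩
      refine ⟨_, ⟨y, hy, rfl⟩, ?_⟩
      refine (hw y (hN hy)).2 ?_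
      have : (fun i => SignType.sign (f i (Ψ (w.1, w.2, y)))) = τ := funext h
      rw [this]; exact hτ
    · rintro ⟨_, ⟨y, hy, rfl⟩, h⟩
      exact ⟨_, (hw y (hN hy)).1 h, y, hy, fun i => rfl⟩

lemma global_dec [FiniteDimensional ℝ Z] {K : Set Z} (hK : IsCompact K) {Q : ℝ × ℝ × Z → Prop}
    (hQK : ∀ z, Q z → z.2.2 ∈ K) (h : ∀ q ∈ K, LD q Q) :
    Dec (fun w => ∃ z, Q (w.1, w.2, z)) := by
  classical
  choose! V hV hdec using fun q (hq : q ∈ K) => local_dec (h q hq)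
  obtain ⟨t, ht, hcov⟩ := hK.elim_nhds_subcover V hV
  have hD : Dec (fun w : ℝ × ℝ => ∃ q : t, ∃ z ∈ V q, Q (w.1, w.2, z)) :=
    Dec.exists fun q => hdec q.1 (ht q.1 q.2)
  refine hD.congr (Eventually.of_forall fun w => ?_)
  constructor
  · rintro ⟨q, z, _, hz⟩; exact ⟨z, hz⟩
  · rintro ⟨z, hz⟩
    have := hcov (hQK _ hz)
    simp only [Set.mem_iUnion] at this
    obtain ⟨q, hq, hzq⟩ := this
    exact ⟨⟨q, hq⟩, z, hzq, hz⟩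

end
end SubHolder
end

section
open Filter Topology
namespace SubHolder

/-! ### Application to subanalytic functions -/

section
variable {Z : Type} [NormedAddCommGroup Z] [NormedSpace ℝ Z]

lemma LD.semi {n : ℕ} {B : Set (Fin n → ℝ)} (hB : IsSemianalytic B) (q : Z)
    (p : Z →L[ℝ] (Fin n → ℝ)) : LD q (fun z => p z.2.2 ∈ B) := by
  obtain ⟨U, hU, hqU, K, L, f, sgn, hf, hBU⟩ := hB (p q)
  have hpa : AnalyticAt ℝ (fun z : ℝ × ℝ × Z => p z.2.2) (0, 0, q) :=
    ((p.comp (ContinuousLinearMap.snd ℝ ℝ Z)).comp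
      (ContinuousLinearMap.snd ℝ ℝ (ℝ × Z))).analyticAt _
  have hfa : ∀ a b, AnalyticAt ℝ (fun z : ℝ × ℝ × Z => f a b (p z.2.2)) (0, 0, q) := fun a b =>
    AnalyticAt.fun_comp (g := f a b) (f := fun z : ℝ × ℝ × Z => p z.2.2)
      ((hU.analyticOn_iff_analyticOnNhd.1 (hf a b)) _ hqU) hpa
  have hLD : LD q (fun z => ∃ a, ∀ b, if sgn a b then 0 < f a b (p z.2.2)
      else f a b (p z.2.2) = 0) := by
    refine LD.exists fun a => LD.forall fun b => ?_
    by_cases hs : sgn a b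
    · simpa [hs] using LD.pos (hfa a b)
    · simpa [hs] using LD.zero (hfa a b)
  refine hLD.congr ?_
  have hev : ∀ᶠ z in 𝓝 ((0, 0, q) : ℝ × ℝ × Z), p z.2.2 ∈ U :=
    hpa.continuousAt.eventually (hU.mem_nhds hqU)
  filter_upwards [hev] with z hz
  have h1 : p z.2.2 ∈ B ↔ p z.2.2 ∈ B ∩ U := by simp [hz]
  rw [h1, hBU]
  simp [hz]

lemma LD.aff (q : Z) (a b c : ℝ) (φ : Z →L[ℝ] ℝ) :
    LD q (fun z => 0 ≤ a * z.1 + b * z.2.1 + φ z.2.2 + c) := by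
  have : AnalyticAt ℝ (fun z : ℝ × ℝ × Z => a * z.1 + b * z.2.1 + φ z.2.2 + c) (0, 0, q) := by
    refine AnalyticAt.add (AnalyticAt.add (AnalyticAt.add ?_ ?_) ?_) analyticAt_const
    · exact analyticAt_const.mul analyticAt_fst
    · exact analyticAt_const.mul ((ContinuousLinearMap.fst ℝ ℝ Z).comp
        (ContinuousLinearMap.snd ℝ ℝ (ℝ × Z)) |>.analyticAt _)
    · exact ((φ.comp (ContinuousLinearMap.snd ℝ ℝ Z)).comp
        (ContinuousLinearMap.snd ℝ ℝ (ℝ × Z))).analyticAt _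
  exact LD.nonneg this

end

lemma dec_main {N : ℕ} (U : Set (Fin N → ℝ))
    (hU : IsOpen U) (h : (Fin N → ℝ) → ℝ) (hcont : ContinuousOn h U)
    (hsub : IsSubanalytic (graphSet U h)) (x0 : Fin N → ℝ) (hx0 : x0 ∈ U) :
    ∃ δ > 0, Metric.closedBall x0 δ ⊆ U ∧
      Dec (fun w => ∃ y ∈ Metric.closedBall x0 δ, ∃ z ∈ Metric.closedBall x0 δ,
        dist y z ≤ w.1 ∧ w.2 ≤ h y - h z) := by
  let G : (Fin N → ℝ) → ℝ → (Fin (N + 1) → ℝ) := fun y t => Fin.snoc (α := fun _ => ℝ) y t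
  have hG1 : ∀ y t i, G y t (Fin.castAdd 1 i) = y i := fun y t i =>
    Fin.snoc_castSucc (α := fun _ => ℝ) (x := t) (p := y) (i := i)
  have hG2 : ∀ y t, G y t (Fin.last N) = t := fun y t => Fin.snoc_last (α := fun _ => ℝ) t y
  obtain ⟨W, hW, hPW, m, B, hB, hBc, hgr⟩ := hsub (G x0 (h x0))
  obtain ⟨ε, hε, hεW⟩ := Metric.nhds_basis_closedBall.mem_iff.1 (hW.mem_nhds hPW)
  have hev : ∀ᶠ y in 𝓝 x0, y ∈ U ∧ |h y - h x0| ≤ ε := by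
    refine Filter.Eventually.and (hU.mem_nhds hx0) ?_
    have := (hcont.continuousAt (hU.mem_nhds hx0)).eventually
      (Metric.closedBall_mem_nhds (h x0) hε)
    simpa [Real.dist_eq] using this
  obtain ⟨δ1, hδ1, hδ1U⟩ := Metric.nhds_basis_closedBall.mem_iff.1 hev
  let δ := min δ1 ε
  have hδ : 0 < δ := lt_min hδ1 hε
  have hδU : ∀ y ∈ Metric.closedBall x0 δ, y ∈ U ∧ |h y - h x0| ≤ ε := fun y hy =>
    hδ1U (Metric.closedBall_subset_closedBall (min_le_left _ _) hy)
  refine ⟨δ, hδ, fun y hy => (hδU y hy).1, ?_⟩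
  let E := Fin (N + 1 + m) → ℝ
  let X : Fin N → E →L[ℝ] ℝ := fun i =>
    ContinuousLinearMap.proj (R := ℝ) (φ := fun _ : Fin (N + 1 + m) => ℝ) (Fin.castAdd m (Fin.castAdd 1 i))
  let Tt : E →L[ℝ] ℝ :=
    ContinuousLinearMap.proj (R := ℝ) (φ := fun _ : Fin (N + 1 + m) => ℝ) (Fin.castAdd m (Fin.last N))
  have hext : ∀ P P' : Fin (N + 1) → ℝ, (∀ i, P (Fin.castAdd 1 i) = P' (Fin.castAdd 1 i)) →
      P (Fin.last N) = P' (Fin.last N) → P = P' := by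
    intro P P' h1 h2
    funext j
    exact Fin.lastCases h2 (fun i => h1 i) j
  have hinW : ∀ P : Fin (N + 1) → ℝ, (∀ i, |P (Fin.castAdd 1 i) - x0 i| ≤ ε) →
      |P (Fin.last N) - h x0| ≤ ε → P ∈ W := by
    intro P h1 h2
    apply hεW
    rw [Metric.mem_closedBall, dist_pi_le_iff hε.le]
    intro j
    rw [Real.dist_eq]
    refine Fin.lastCases ?_ (fun i => ?_) j
    · rw [hG2]; exact h2
    · have := h1 i
      rw [← hG1 x0 (h x0) i] at this; exact this
  have hcb : ∀ y : Fin N → ℝ, y ∈ Metric.closedBall x0 δ ↔ ∀ i, |y i - x0 i| ≤ δ := by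
    intro y
    rw [Metric.mem_closedBall, dist_pi_le_iff hδ.le]
    simp [Real.dist_eq]
  have fact1 : ∀ y ∈ Metric.closedBall x0 δ, ∃ b ∈ B, (∀ i, X i b = y i) ∧ Tt b = h y := by
    intro y hy
    have hmem : G y (h y) ∈ graphSet U h ∩ W := by
      refine ⟨⟨?_, ?_⟩, hinW _ ?_ ?_⟩
      · simp only [hG1]; exact (hδU y hy).1
      · simp only [hG1, hG2]
      · intro i; rw [hG1]; exact ((hcb y).1 hy i).trans (min_le_right _ _)
      · rw [hG2]; exact (hδU y hy).2
    rw [hgr] at hmem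
    obtain ⟨⟨b, hb, hbe⟩, _⟩ := hmem
    refine ⟨b, hb, fun i => ?_, ?_⟩
    · have := congrFun hbe (Fin.castAdd 1 i)
      rw [hG1] at this; exact this
    · have := congrFun hbe (Fin.last N)
      rw [hG2] at this; exact this
  have fact2 : ∀ b ∈ B, (∀ i, |X i b - x0 i| ≤ δ) → |Tt b - h x0| ≤ ε →
      Tt b = h (fun i => X i b) := by
    intro b hb h1 h2
    have : (fun i : Fin (N + 1) => b (Fin.castAdd m i)) ∈ graphSet U h ∩ W := by
      rw [hgr]
      refine ⟨⟨b, hb, rfl⟩, hinW _ (fun i => (h1 i).trans (min_le_right _ _)) h2⟩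
    exact this.1.2
  let F1 := ContinuousLinearMap.fst ℝ E E
  let F2 := ContinuousLinearMap.snd ℝ E E
  let Q : ℝ × ℝ × (E × E) → Prop := fun z =>
    ((z.2.2.1 ∈ B ∧ (∀ i, |X i z.2.2.1 - x0 i| ≤ δ) ∧ |Tt z.2.2.1 - h x0| ≤ ε) ∧
     (z.2.2.2 ∈ B ∧ (∀ i, |X i z.2.2.2 - x0 i| ≤ δ) ∧ |Tt z.2.2.2 - h x0| ≤ ε)) ∧
    ((∀ i, |X i z.2.2.1 - X i z.2.2.2| ≤ z.1) ∧ z.2.1 ≤ Tt z.2.2.1 - Tt z.2.2.2)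
  have habs : ∀ (q : E × E) (φ : E × E →L[ℝ] ℝ) (c d : ℝ),
      LD q (fun z => |φ z.2.2 - c| ≤ d) := by
    intro q φ c d
    refine ((LD.aff q 0 0 (d - c) φ).and (LD.aff q 0 0 (d + c) (-φ))).congr
      (Eventually.of_forall fun z => ?_)
    rw [abs_le, neg_apply]
    constructor
    · rintro ⟨h1, h2⟩; constructor <;> linarith
    · rintro ⟨h1, h2⟩; constructor <;> linarith
  have hhalf : ∀ (q : E × E) (p : E × E →L[ℝ] E), LD q (fun z => p z.2.2 ∈ B ∧
      (∀ i, |X i (p z.2.2) - x0 i| ≤ δ) ∧ |Tt (p z.2.2) - h x0| ≤ ε) := fun q p =>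
    (LD.semi hB q p).and ((LD.forall fun i => habs q ((X i).comp p) (x0 i) δ).and
      (habs q (Tt.comp p) (h x0) ε))
  have hlast : ∀ q : E × E, LD q (fun z => (∀ i, |X i z.2.2.1 - X i z.2.2.2| ≤ z.1) ∧
      z.2.1 ≤ Tt z.2.2.1 - Tt z.2.2.2) := by
    intro q
    refine (LD.forall fun i => ?_).and ?_
    · refine ((LD.aff q 1 0 0 ((X i).comp F1 - (X i).comp F2)).and
        (LD.aff q 1 0 0 ((X i).comp F2 - (X i).comp F1))).congr
        (Eventually.of_forall fun z => ?_)
      change (0 ≤ 1 * z.1 + 0 * z.2.1 + (X i z.2.2.1 - X i z.2.2.2) + 0 ∧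
        0 ≤ 1 * z.1 + 0 * z.2.1 + (X i z.2.2.2 - X i z.2.2.1) + 0) ↔ _
      rw [abs_le]
      constructor
      · rintro ⟨h1, h2⟩; constructor <;> linarith
      · rintro ⟨h1, h2⟩; constructor <;> linarith
    · refine (LD.aff q 0 (-1) 0 (Tt.comp F1 - Tt.comp F2)).congr
        (Eventually.of_forall fun z => ?_)
      change (0 ≤ 0 * z.1 + (-1) * z.2.1 + (Tt z.2.2.1 - Tt z.2.2.2) + 0) ↔ _
      constructor
      · intro h1; linarith
      · intro h1; linarith
  have hLD : ∀ q : E × E, LD q Q := fun q =>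
    ((hhalf q F1).and (hhalf q F2)).and (hlast q)
  have hD := global_dec (hBc.prod hBc) (Q := Q)
    (fun z hz => ⟨subset_closure hz.1.1.1, subset_closure hz.1.2.1⟩) (fun q _ => hLD q)
  refine hD.congr ?_
  filter_upwards [FF_pos] with w hw
  constructor
  · rintro ⟨⟨b, b'⟩, ⟨⟨hb, hb1, hb2⟩, hb', hb1', hb2'⟩, hd, ht⟩
    have e1 := fact2 b hb hb1 hb2
    have e2 := fact2 b' hb' hb1' hb2'
    refine ⟨fun i => X i b, (hcb _).2 hb1, fun i => X i b', (hcb _).2 hb1', ?_, ?_⟩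
    · rw [dist_pi_le_iff hw.1.le]
      exact hd
    · rw [← e1, ← e2]; exact ht
  · rintro ⟨y, hy, z, hz, hd, ht⟩
    obtain ⟨b, hb, h1, h2⟩ := fact1 y hy
    obtain ⟨b', hb', h1', h2'⟩ := fact1 z hz
    refine ⟨(b, b'), ⟨⟨hb, fun i => ?_, ?_⟩, hb', fun i => ?_, ?_⟩, fun i => ?_, ?_⟩
    · change |X i b - x0 i| ≤ δ
      rw [h1]; exact (hcb y).1 hy i
    · change |Tt b - h x0| ≤ ε
      rw [h2]; exact (hδU y hy).2
    · change |X i b' - x0 i| ≤ δ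
      rw [h1']; exact (hcb z).1 hz i
    · change |Tt b' - h x0| ≤ ε
      rw [h2']; exact (hδU z hz).2
    · change |X i b - X i b'| ≤ w.1
      rw [h1, h1']
      exact ((dist_pi_le_iff hw.1.le).1 hd) i
    · change w.2 ≤ Tt b - Tt b'
      rw [h2, h2']; exact ht

theorem holder_main {N : ℕ} (U : Set (Fin N → ℝ))
    (hU : IsOpen U) (h : (Fin N → ℝ) → ℝ) (hcont : ContinuousOn h U)
    (hsub : IsSubanalytic (graphSet U h)) :
    ∀ x ∈ U, ∃ V ∈ nhds x, V ⊆ U ∧ ∃ C > (0 : ℝ), ∃ α > (0 : ℝ),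
      ∀ y ∈ V, ∀ z ∈ V, |h y - h z| ≤ C * dist y z ^ α := by
  intro x0 hx0
  obtain ⟨δ, hδ, hδU, hD⟩ := dec_main U hU h hcont hsub x0 hx0
  rcases hD with hD | hD
  · exfalso
    obtain ⟨k, hk⟩ := FF_iff.1 hD
    have hu : UniformContinuousOn h (Metric.closedBall x0 δ) :=
      (isCompact_closedBall x0 δ).uniformContinuousOn_of_continuous (hcont.mono hδU)
    let t : ℝ := 1 / ((k : ℝ) + 2)
    have ht : 0 < t := by positivity
    have ht' : t < 1 / ((k : ℝ) + 1) := by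
      apply one_div_lt_one_div_of_lt (by positivity); linarith
    obtain ⟨η, hη, hu'⟩ := Metric.uniformContinuousOn_iff.1 hu t ht
    have htk : 0 < t ^ k := pow_pos ht k
    have hm : 0 < min η (t ^ k) := lt_min hη htk
    obtain ⟨y, hy, z, hz, hd, hh⟩ := hk (min η (t ^ k) / 2, t)
      ⟨ht, ht', by simpa using hm, (half_lt_self hm).trans_le (min_le_right _ _)⟩
    have hd' : dist y z < η := lt_of_le_of_lt hd ((half_lt_self hm).trans_le (min_le_left _ _))
    have := hu' y hy z hz hd'
    rw [Real.dist_eq] at this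
    have h3 := le_abs_self (h y - h z)
    simp only at hh
    linarith
  · obtain ⟨k, hk⟩ := FF_iff.1 hD
    have hk1 : (0 : ℝ) < (k : ℝ) + 1 := by positivity
    let r : ℝ := (1 / ((k : ℝ) + 1)) ^ (k + 1)
    have hr : 0 < r := by positivity
    let δ1 := min δ (r / 4)
    have hδ1 : 0 < δ1 := lt_min hδ (by positivity)
    have hsubb : Metric.ball x0 δ1 ⊆ Metric.closedBall x0 δ :=
      Metric.ball_subset_closedBall.trans (Metric.closedBall_subset_closedBall (min_le_left _ _))
    let α : ℝ := 1 / ((k : ℝ) + 1)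
    have hα : 0 < α := by positivity
    refine ⟨Metric.ball x0 δ1, Metric.ball_mem_nhds x0 hδ1, hsubb.trans hδU,
      2 ^ α, by positivity, α, hα, ?_⟩
    have key : ∀ y ∈ Metric.ball x0 δ1, ∀ z ∈ Metric.ball x0 δ1, 0 < dist y z →
        h y - h z ≤ 2 ^ α * dist y z ^ α := by
      intro y hy z hz hd
      rw [← Real.mul_rpow (by norm_num) hd.le]
      set d := dist y z with hdd
      have hd2 : 2 * d < r := by
        have h1 : d ≤ dist y x0 + dist x0 z := dist_triangle _ _ _
        rw [dist_comm x0 z] at h1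
        have h2 : dist y x0 < δ1 := hy
        have h3 : dist z x0 < δ1 := hz
        have h4 : δ1 ≤ r / 4 := min_le_right _ _
        linarith
      have ht : 0 < (2 * d) ^ α := by positivity
      have htk : ((2 * d) ^ α) ^ (k + 1) = 2 * d := by
        rw [← Real.rpow_natCast, ← Real.rpow_mul (by positivity)]
        have : α * ((k + 1 : ℕ) : ℝ) = 1 := by
          simp only [α]; push_cast; field_simp
        rw [this, Real.rpow_one]
      have htl : (2 * d) ^ α < 1 / ((k : ℝ) + 1) := by
        refine lt_of_pow_lt_pow_left₀ (k + 1) (by positivity) ?_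
        rw [htk]; exact hd2
      have ht1 : (2 * d) ^ α ≤ 1 := by
        refine htl.le.trans ?_
        rw [div_le_one hk1]
        have : (0 : ℝ) ≤ k := by positivity
        linarith
      have hdk : d < ((2 * d) ^ α) ^ k := by
        calc d < 2 * d := by linarith
          _ = ((2 * d) ^ α) ^ (k + 1) := htk.symm
          _ ≤ ((2 * d) ^ α) ^ k := pow_le_pow_of_le_one ht.le ht1 (Nat.le_succ k)
      by_contra hcon
      exact hk (d, (2 * d) ^ α) ⟨ht, htl, hd, hdk⟩
        ⟨y, hsubb hy, z, hsubb hz, le_refl _, (not_le.1 hcon).le⟩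
    intro y hy z hz
    rcases (dist_nonneg (x := y) (y := z)).eq_or_lt with hd | hd
    · have : y = z := dist_eq_zero.1 hd.symm
      subst this
      rw [sub_self, abs_zero]
      positivity
    · rw [abs_le]
      have h1 := key y hy z hz hd
      have h2 := key z hz y hy (by rwa [dist_comm])
      rw [dist_comm z y] at h2
      constructor <;> linarith

end SubHolder
end

/-- Łojasiewicz inequality for subanalytic continuous functions:
a continuous subanalytic function is locally Hölder: every point has a neighborhood
`V` and constants `C > 0`, `α > 0` with `|h(x) − h(x')| ≤ C |x − x'|^α` on `V`. -/
theorem subanalytic_continuous_locally_holder {N : ℕ} (U : Set (Fin N → ℝ))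
    (hU : IsOpen U) (h : (Fin N → ℝ) → ℝ) (hcont : ContinuousOn h U)
    (hsub : IsSubanalytic (graphSet U h)) :
    ∀ x ∈ U, ∃ V ∈ nhds x, V ⊆ U ∧ ∃ C > (0 : ℝ), ∃ α > (0 : ℝ),
      ∀ y ∈ V, ∀ z ∈ V, |h y - h z| ≤ C * dist y z ^ α := by
  exact SubHolder.holder_main U hU h hcont hsub
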